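/- For each a ∈ {0,1,2,3,4,5}, the formal power series Σ_{n≥0} (11·M(a,11,n) − p(n))·q^n equals J_{121}^2 · ( a_0·X_1^{-1} + a_1·q·X_5·X_2^{-1}·X_3^{-1} + a_2·q^2·X_3·X_1^{-1}·X_4^{-1} + a_3·q^3·X_2·X_1^{-1}·X_3^{-1} + a_4·q^4·X_2^{-1} + a_5·q^5·X_4·X_2^{-1}·X_5^{-1} + a_7·q^7·X_3^{-1} + a_8·q^{19}·X_1·X_4^{-1}·X_5^{-1} + a_9·q^9·X_4^{-1} + a_{10}·q^{10}·X_5^{-1} ), where the integer coefficient vector (a_0,a_1,a_2,a_3,a_4,a_5,a_7,a_8,a_9,a_{10}) is: for a=0: (10,−12,−2,8,6,4,−4,−6,−8,2); for a=1: (−1,10,−2,−3,−5,4,7,5,3,2); for a=2: (−1,−1,9,−3,6,−7,−4,−6,3,2); for a=3: (−1,−1,−2,8,−5,4,−4,5,3,−9); for a=4: (−1,−1,−2,−3,6,−7,7,5,−8,2); for a=5: (−1,−1,−2,−3,−5,4,−4,−6,3,2). -/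

import Mathlib

/-- `p n`: the number of partitions of `n`. -/
def partitionCount (n : ℕ) : ℕ := Fintype.card (Nat.Partition n)

/-- The rank of a partition: its largest part minus its number of parts
(the empty partition has rank 0). -/
def partitionRank {n : ℕ} (π : Nat.Partition n) : ℤ :=
  (π.parts.sup : ℤ) - (Multiset.card π.parts : ℤ)

/-- The crank of a partition `π`: if `π` has no parts equal to 1, it is the largest part;
otherwise it is (number of parts larger than the number of ones) − (number of ones). -/
def partitionCrank {n : ℕ} (π : Nat.Partition n) : ℤ :=
  if π.parts.count 1 = 0 then (π.parts.sup : ℤ)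
  else ((π.parts.filter fun x => π.parts.count 1 < x).card : ℤ) - (π.parts.count 1 : ℤ)

/-- `rankCount a r n` = `N(a,r,n)`: the number of partitions of `n` whose rank is
congruent to `a` modulo `r`. -/
def rankCount (a r : ℤ) (n : ℕ) : ℕ :=
  (Finset.univ.filter fun π : Nat.Partition n => partitionRank π % r = a % r).card

/-- `crankCount a n` = `M(a,11,n)`: for `n ≠ 1`, the number of partitions of `n` whose crank
is congruent to `a` modulo 11; at `n = 1` the standard convention `M(0,11,1) = −1`,
`M(1,11,1) = M(10,11,1) = 1`, and `M(a,11,1) = 0` otherwise. -/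
def crankCount (a : ℤ) (n : ℕ) : ℤ :=
  if n = 1 then
    if a % 11 = 0 then -1
    else if a % 11 = 1 ∨ a % 11 = 10 then 1
    else 0
  else ((Finset.univ.filter fun π : Nat.Partition n => partitionCrank π % 11 = a % 11).card : ℤ)

noncomputable section

/-- The Euler product `J_m = (q^m;q^m)_∞` as a q-series, via the pentagonal number theorem:
`J_m = Σ_{k∈ℤ} (−1)^k q^{m·k(3k−1)/2}` (the condition below is the exponent equation
cleared of denominators; all solutions `k` satisfy `|k| ≤ n`). -/
def Jser (m : ℤ) : PowerSeries ℚ :=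
  PowerSeries.mk fun n =>
    ∑ k ∈ Finset.Icc (-(n : ℤ)) (n : ℤ),
      if m * (k * (3 * k - 1)) = 2 * (n : ℤ) then (-1 : ℚ) ^ k.natAbs else 0

/-- The theta function `j(a,m) = Σ_{k∈ℤ} (−1)^k q^{m·k(k−1)/2 + a·k}` (for `0 < a < m`;
the condition below is the exponent equation cleared of denominators; all solutions `k`
satisfy `|k| ≤ n`). -/
def jtheta (a m : ℤ) : PowerSeries ℚ :=
  PowerSeries.mk fun n =>
    ∑ k ∈ Finset.Icc (-(n : ℤ)) (n : ℤ),
      if m * (k * (k - 1)) + 2 * a * k = 2 * (n : ℤ) then (-1 : ℚ) ^ k.natAbs else 0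

/-- `X_i := j(11i, 121)`. -/
def Xser (i : ℤ) : PowerSeries ℚ := jtheta (11 * i) 121

/-- The combination of theta quotients appearing in the 11-dissection of the crank deviations. -/
def v11 (a0 a1 a2 a3 a4 a5 a7 a8 a9 a10 : ℤ) : PowerSeries ℚ :=
  (Jser 121) ^ 2 *
    ( (a0 : PowerSeries ℚ) * (Xser 1)⁻¹
    + (a1 : PowerSeries ℚ) * PowerSeries.X * (Xser 5) * (Xser 2)⁻¹ * (Xser 3)⁻¹
    + (a2 : PowerSeries ℚ) * PowerSeries.X ^ 2 * (Xser 3) * (Xser 1)⁻¹ * (Xser 4)⁻¹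
    + (a3 : PowerSeries ℚ) * PowerSeries.X ^ 3 * (Xser 2) * (Xser 1)⁻¹ * (Xser 3)⁻¹
    + (a4 : PowerSeries ℚ) * PowerSeries.X ^ 4 * (Xser 2)⁻¹
    + (a5 : PowerSeries ℚ) * PowerSeries.X ^ 5 * (Xser 4) * (Xser 2)⁻¹ * (Xser 5)⁻¹
    + (a7 : PowerSeries ℚ) * PowerSeries.X ^ 7 * (Xser 3)⁻¹
    + (a8 : PowerSeries ℚ) * PowerSeries.X ^ 19 * (Xser 1) * (Xser 4)⁻¹ * (Xser 5)⁻¹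
    + (a9 : PowerSeries ℚ) * PowerSeries.X ^ 9 * (Xser 4)⁻¹
    + (a10 : PowerSeries ℚ) * PowerSeries.X ^ 10 * (Xser 5)⁻¹ )

namespace CrankDissection
open Filter Topology

/-- The triangular number `k(k-1)/2`. -/
def tri (k : ℤ) : ℤ := k * (k - 1) / 2

lemma two_mul_tri (k : ℤ) : 2 * tri k = k * (k - 1) :=
  Int.two_mul_ediv_two_of_even (by
    have := Int.even_mul_succ_self (k - 1)
    rwa [sub_add_cancel, mul_comm] at this)

lemma tri_add (m s : ℤ) : tri (m + s) = tri m + tri s + m * s := by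
  have h1 := two_mul_tri (m + s)
  have h2 := two_mul_tri m
  have h3 := two_mul_tri s
  linarith [h1, h2, h3, mul_comm m s,
    show (m + s) * (m + s - 1) = m * (m - 1) + s * (s - 1) + 2 * (m * s) by ring]

lemma tri_one_sub (k : ℤ) : tri (1 - k) = tri k := by
  have h1 := two_mul_tri (1 - k)
  have h2 := two_mul_tri k
  linarith [show (1 - k) * (1 - k - 1) = k * (k - 1) by ring]

lemma tri_mul (n m : ℤ) : tri (n * m) = n ^ 2 * tri m + tri n * m := by
  have h1 := two_mul_tri (n * m)
  have h2 := two_mul_tri m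
  have h3 := two_mul_tri n
  refine mul_left_cancel₀ (two_ne_zero (α := ℤ)) ?_
  linear_combination h1 - n ^ 2 * h2 - m * h3

/-- The `k`-th term of the theta series. -/
def thetaTerm (q x : ℂ) (k : ℤ) : ℂ := (-1) ^ k * q ^ tri k * x ^ k

/-- The theta series `∑ (-1)^k q^(k(k-1)/2) x^k`. -/
def theta (q x : ℂ) : ℂ := ∑' k : ℤ, thetaTerm q x k

lemma thetaTerm_ne_zero {q x : ℂ} (hq : q ≠ 0) (hx : x ≠ 0) (k : ℤ) : thetaTerm q x k ≠ 0 :=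
  mul_ne_zero (mul_ne_zero (zpow_ne_zero _ (by simp)) (zpow_ne_zero _ hq)) (zpow_ne_zero _ hx)

lemma thetaTerm_add_one {q x : ℂ} (hq : q ≠ 0) (hx : x ≠ 0) (k : ℤ) :
    thetaTerm q x (k + 1) = -(q ^ k * x) * thetaTerm q x k := by
  have h : tri (k + 1) = tri k + k := by rw [tri_add]; simp [tri]
  simp only [thetaTerm]
  rw [h, zpow_add₀ hq, zpow_add₀ hx, zpow_add₀ (by norm_num : (-1 : ℂ) ≠ 0)]
  simp only [zpow_one]
  ring

lemma thetaTerm_one_sub {q x : ℂ} (hx : x ≠ 0) (k : ℤ) :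
    thetaTerm q x (1 - k) = -x * thetaTerm q x⁻¹ k := by
  simp only [thetaTerm]
  rw [tri_one_sub, zpow_sub₀ hx, zpow_sub₀ (by norm_num : (-1 : ℂ) ≠ 0), inv_zpow]
  have : ((-1 : ℂ) ^ k)⁻¹ = (-1) ^ k := by rw [← inv_zpow]; norm_num
  simp only [zpow_one, div_eq_mul_inv, this]
  ring

lemma summable_thetaTerm_nat {q x : ℂ} (hq : q ≠ 0) (hq1 : ‖q‖ < 1) (hx : x ≠ 0) :
    Summable fun n : ℕ => thetaTerm q x n := by
  refine summable_of_ratio_test_tendsto_lt_one (l := 0) zero_lt_one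
    (Eventually.of_forall fun n => thetaTerm_ne_zero hq hx _) ?_
  have : ∀ n : ℕ, ‖thetaTerm q x (n + 1 : ℕ)‖ / ‖thetaTerm q x n‖ = ‖q‖ ^ n * ‖x‖ := by
    intro n
    push_cast
    rw [thetaTerm_add_one hq hx, norm_mul, mul_div_cancel_right₀ _
      (norm_ne_zero_iff.2 (thetaTerm_ne_zero hq hx _))]
    simp
  simp_rw [this]
  simpa using (tendsto_pow_atTop_nhds_zero_of_lt_one (norm_nonneg q) hq1).mul_const ‖x‖

lemma summable_thetaTerm {q x : ℂ} (hq : q ≠ 0) (hq1 : ‖q‖ < 1) (hx : x ≠ 0) :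
    Summable (thetaTerm q x) := by
  have h2 := (summable_thetaTerm_nat hq hq1 (inv_ne_zero hx)).mul_left (-x)
  simp_rw [← thetaTerm_one_sub hx] at h2
  refine Summable.of_nat_of_neg_add_one (summable_thetaTerm_nat hq hq1 hx) ?_
  refine ((summable_nat_add_iff 2).2 h2).congr fun n => ?_
  rw [show -((n : ℤ) + 1) = 1 - ((n + 2 : ℕ) : ℤ) by push_cast; ring]

lemma hasSum_theta {q x : ℂ} (hq : q ≠ 0) (hq1 : ‖q‖ < 1) (hx : x ≠ 0) :
    HasSum (thetaTerm q x) (theta q x) := (summable_thetaTerm hq hq1 hx).hasSum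

lemma theta_inv {q x : ℂ} (hx : x ≠ 0) : theta q x⁻¹ = -theta q x / x := by
  have h : theta q x = -x * theta q x⁻¹ := by
    unfold theta
    rw [← tsum_mul_left, ← (Equiv.subLeft (1 : ℤ)).tsum_eq]
    exact tsum_congr fun k => thetaTerm_one_sub hx k
  rw [h]; field_simp

lemma theta_mul_left {q x : ℂ} (hq : q ≠ 0) (hx : x ≠ 0) : theta q (q * x) = -theta q x / x := by
  have h : theta q x = -x * theta q (q * x) := by
    unfold theta
    rw [← tsum_mul_left, ← (Equiv.addRight (1 : ℤ)).tsum_eq]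
    refine tsum_congr fun k => ?_
    rw [Equiv.coe_addRight, thetaTerm_add_one hq hx]
    simp only [thetaTerm, mul_zpow]; ring
  rw [h]; field_simp

lemma theta_div {q x : ℂ} (hq : q ≠ 0) (hx : x ≠ 0) : theta q (q / x) = theta q x := by
  rw [div_eq_mul_inv, theta_mul_left hq (inv_ne_zero hx), theta_inv hx]; field_simp

lemma theta_one {q : ℂ} : theta q 1 = 0 := by
  have h := theta_inv (q := q) one_ne_zero
  simp only [inv_one, div_one] at h
  linear_combination h / 2

lemma thetaTerm_add_eleven_mul {q x : ℂ} (hq : q ≠ 0) (hx : x ≠ 0) (t m : ℤ) :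
    thetaTerm q x (t + 11 * m) =
      thetaTerm q x t * thetaTerm (q ^ 121) (q ^ (11 * (t + 5)) * x ^ 11) m := by
  have h : tri (t + 11 * m) = tri t + 121 * tri m + 11 * (t + 5) * m := by
    rw [tri_add, tri_mul, show tri 11 = 55 from rfl]
    ring
  have h1 : (-1 : ℂ) ^ (11 : ℤ) = -1 := by norm_num
  simp only [thetaTerm]
  rw [h, zpow_add₀ hq, zpow_add₀ hq, zpow_add₀ hx, zpow_add₀ (by norm_num : (-1 : ℂ) ≠ 0),
    zpow_mul (-1), h1, mul_zpow, ← zpow_mul q, zpow_mul x, zpow_mul q 121]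
  norm_cast
  ring

/-- Splitting the theta series along residue classes modulo 11 starting at `o`. -/
lemma theta_split {q x : ℂ} (hq : q ≠ 0) (hq1 : ‖q‖ < 1) (hx : x ≠ 0) (o : ℤ) :
    theta q x = ∑ s : Fin 11, thetaTerm q x (o + s) *
      theta (q ^ 121) (q ^ (11 * (o + s + 5)) * x ^ 11) := by
  have hQ1 : ‖q ^ 121‖ < 1 := by
    rw [norm_pow]; exact pow_lt_one₀ (norm_nonneg _) hq1 (by norm_num)
  have hs := hasSum_theta hq hq1 hx
  let e : Fin 11 × ℤ ≃ ℤ := (Equiv.prodComm _ _).trans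
    ((Int.divModEquiv 11).symm.trans (Equiv.addLeft o))
  have he : ∀ s m, e (s, m) = o + (m * 11 + s) := fun s m => by simp [e]
  rw [← e.hasSum_iff] at hs
  refine (hs.prod_fiberwise (g := fun s : Fin 11 => thetaTerm q x (o + s) *
      theta (q ^ 121) (q ^ (11 * (o + s + 5)) * x ^ 11)) fun s => ?_).unique (hasSum_fintype _)
  have h := (hasSum_theta (pow_ne_zero 121 hq) hQ1
    (mul_ne_zero (zpow_ne_zero (11 * (o + s + 5)) hq) (pow_ne_zero 11 hx))).mul_left
      (thetaTerm q x (o + s))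
  refine h.congr_fun fun m => ?_
  rw [Function.comp_apply, he, show o + (m * 11 + (s : ℤ)) = o + s + 11 * m by ring,
    thetaTerm_add_eleven_mul hq hx]

/-- The infinite product `∏ (1 - x q^n)`. -/
def poch (q x : ℂ) : ℂ := ∏' n : ℕ, (1 - x * q ^ n)

lemma summable_mul_pow {q : ℂ} (hq1 : ‖q‖ < 1) (x : ℂ) : Summable fun n : ℕ => ‖-(x * q ^ n)‖ := by
  simpa using (summable_geometric_of_lt_one (norm_nonneg q) hq1).mul_left ‖x‖

lemma multipliable_poch {q : ℂ} (hq1 : ‖q‖ < 1) (x : ℂ) :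
    Multipliable fun n : ℕ => 1 - x * q ^ n := by
  simpa [sub_eq_add_neg] using multipliable_one_add_of_summable (summable_mul_pow hq1 x)

lemma tendsto_poch {q : ℂ} (hq1 : ‖q‖ < 1) (x : ℂ) :
    Tendsto (fun N => ∏ n ∈ Finset.range N, (1 - x * q ^ n)) atTop (𝓝 (poch q x)) :=
  (multipliable_poch hq1 x).hasProd.tendsto_prod_nat

lemma poch_ne_zero {q : ℂ} (hq1 : ‖q‖ < 1) {x : ℂ} (h : ∀ n : ℕ, 1 - x * q ^ n ≠ 0) :
    poch q x ≠ 0 := by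
  have := tprod_one_add_ne_zero_of_summable (f := fun n : ℕ => -(x * q ^ n))
    (fun n => by simpa [sub_eq_add_neg] using h n) (summable_mul_pow hq1 x)
  simpa [poch, sub_eq_add_neg] using this

lemma one_sub_mul_pow_ne_zero {q x : ℂ} (hq1 : ‖q‖ < 1) (hx : ‖x‖ < 1) (n : ℕ) :
    1 - x * q ^ n ≠ 0 := by
  intro h
  have h1 : ‖x * q ^ n‖ < 1 := by
    rw [norm_mul, norm_pow]
    calc ‖x‖ * ‖q‖ ^ n ≤ ‖x‖ * 1 := by
          gcongr; exact pow_le_one₀ (norm_nonneg _) hq1.le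
      _ < 1 := by simpa
  rw [← sub_eq_zero.1 h] at h1
  simp at h1

lemma poch_self_ne_zero {q : ℂ} (hq1 : ‖q‖ < 1) : poch q q ≠ 0 :=
  poch_ne_zero hq1 (one_sub_mul_pow_ne_zero hq1 hq1)

lemma poch_eq_one_sub_mul {q : ℂ} (hq1 : ‖q‖ < 1) (x : ℂ) :
    poch q x = (1 - x) * poch q (x * q) := by
  have h1 := (tendsto_poch hq1 x).comp (tendsto_add_atTop_nat 1)
  refine tendsto_nhds_unique h1 (((tendsto_poch hq1 (x * q)).const_mul (1 - x)).congr fun N => ?_)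
  rw [Function.comp_apply, Finset.prod_range_succ', mul_comm]
  simp [pow_succ', mul_assoc]

/-- The finite product `∏_{1 ≤ i ≤ n} (1 - q^i)`. -/
def qfac (q : ℂ) (n : ℕ) : ℂ := ∏ i ∈ Finset.range n, (1 - q * q ^ i)

lemma qfac_ne_zero {q : ℂ} (hq1 : ‖q‖ < 1) (n : ℕ) : qfac q n ≠ 0 :=
  Finset.prod_ne_zero_iff.2 fun i _ => one_sub_mul_pow_ne_zero hq1 hq1 i

/-- The reciprocal of the `q`-factorial, extended by zero to negative integers. -/
def invQfac (q : ℂ) (m : ℤ) : ℂ := if 0 ≤ m then (qfac q m.toNat)⁻¹ else 0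

lemma invQfac_sub_one {q : ℂ} (hq1 : ‖q‖ < 1) (m : ℤ) :
    invQfac q (m - 1) = (1 - q ^ m) * invQfac q m := by
  rcases lt_trichotomy m 0 with h | rfl | h
  · simp [invQfac, h.not_ge, show ¬ (1 ≤ m) by omega]
  · simp [invQfac]
  · obtain ⟨n, rfl⟩ : ∃ n : ℕ, m = n + 1 := ⟨(m - 1).toNat, by omega⟩
    have h2 : (1 - q * q ^ n) ≠ 0 := one_sub_mul_pow_ne_zero hq1 hq1 n
    have h3 := qfac_ne_zero hq1 n
    have h4 : ((n : ℤ) + 1).toNat = n + 1 := by omega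
    have h5 : q ^ ((n : ℤ) + 1) = q * q ^ n := by
      rw [← pow_succ']; exact_mod_cast rfl
    simp only [invQfac, add_sub_cancel_right, Nat.cast_nonneg, if_true, Int.toNat_natCast, h.le, h4,
      h5]
    rw [show qfac q (n + 1) = qfac q n * (1 - q * q ^ n) from Finset.prod_range_succ _ _]
    field_simp

theorem hasSum_of_eq {α : Type*} {f g : α → ℂ} {s t : ℂ} (h : HasSum f s)
    (hf : ∀ k, g k = f k) (hs : t = s) : HasSum g t := by
  rw [hs, funext hf]; exact h

lemma hasSum_shift {f : ℤ → ℂ} {s : ℂ} (h : HasSum f s) (a : ℤ) :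
    HasSum (fun k => f (k + a)) s :=
  (Equiv.addRight a).hasSum_iff.2 h

/-- The finite form of the Jacobi triple product. -/
lemma hasSum_finite_triple {q x : ℂ} (hq : q ≠ 0) (hq1 : ‖q‖ < 1) (hx : x ≠ 0) (n : ℕ) :
    HasSum (fun k : ℤ => thetaTerm q x k * (invQfac q (n + k) * invQfac q (n - k)))
      ((∏ i ∈ Finset.range n, (1 - x * q ^ i)) * (∏ i ∈ Finset.range n, (1 - q / x * q ^ i)) *
        (qfac q (2 * n))⁻¹) := by
  induction n with
  | zero =>
    convert hasSum_ite_eq (0 : ℤ) (1 : ℂ) using 2 with k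
    · rcases lt_trichotomy k 0 with h | rfl | h
      · simp [invQfac, h.not_ge, h.ne]
      · simp [invQfac, qfac, thetaTerm, tri]
      · simp [invQfac, h.not_ge, h.ne']
    · simp [qfac]
  | succ n ih =>
    have h1 := ih.mul_left (1 + q ^ (2 * n + 1))
    have h2 := (hasSum_shift ih (-1)).mul_left (x * q ^ n)
    have h3 := (hasSum_shift ih 1).mul_left (q ^ (n + 1) / x)
    have h4 := ((h1.sub h2).sub h3).mul_left
      (((1 - q ^ (2 * n + 1)) * (1 - q ^ (2 * n + 2)))⁻¹)
    have e1 : (1 - q ^ (2 * n + 1)) ≠ 0 := by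
      rw [pow_succ']; exact one_sub_mul_pow_ne_zero hq1 hq1 _
    have e2 : (1 - q ^ (2 * n + 2)) ≠ 0 := by
      rw [pow_succ']; exact one_sub_mul_pow_ne_zero hq1 hq1 _
    have e3 := qfac_ne_zero hq1 (2 * n)
    refine hasSum_of_eq h4 (fun k => ?_) ?_
    · have t1 : thetaTerm q x (k + 1) = -(q ^ k * x) * thetaTerm q x k := thetaTerm_add_one hq hx k
      have t2 : x * q ^ k * thetaTerm q x (k + -1) = -q * thetaTerm q x k := by
        have := thetaTerm_add_one hq hx (k + -1)
        rw [neg_add_cancel_right, zpow_add₀ hq, zpow_neg_one] at this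
        rw [this]; field_simp
      have t2' : thetaTerm q x (k + -1) = -q * thetaTerm q x k / (x * q ^ k) := by
        rw [← t2]; field_simp
      set A : ℤ := n + 1 + k with hA
      set B : ℤ := n + 1 - k with hB
      have a1 : invQfac q (n + k) = (1 - q ^ A) * invQfac q A := by
        rw [← invQfac_sub_one hq1, hA]; congr 1; ring
      have a2 : invQfac q (n + (k + -1)) = (1 - q ^ (A - 1)) * ((1 - q ^ A) * invQfac q A) := by
        rw [← invQfac_sub_one hq1, ← invQfac_sub_one hq1, hA]; congr 1; ring
      have a3 : invQfac q (n + (k + 1)) = invQfac q A := by rw [hA]; congr 1; ring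
      have b1 : invQfac q (n - k) = (1 - q ^ B) * invQfac q B := by
        rw [← invQfac_sub_one hq1, hB]; congr 1; ring
      have b2 : invQfac q (n - (k + 1)) = (1 - q ^ (B - 1)) * ((1 - q ^ B) * invQfac q B) := by
        rw [← invQfac_sub_one hq1, ← invQfac_sub_one hq1, hB]; congr 1; ring
      have b3 : invQfac q (n - (k + -1)) = invQfac q B := by rw [hB]; congr 1; ring
      push_cast
      rw [t1, t2', a1, a2, a3, b1, b2, b3, zpow_sub_one₀ hq, zpow_sub_one₀ hq, hA, hB,
        zpow_add₀ hq, zpow_sub₀ hq, zpow_add₀ hq]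
      simp only [zpow_natCast, zpow_one]
      generalize invQfac q (n + 1 + k) = u
      generalize invQfac q (n + 1 - k) = v
      have hk : q ^ k ≠ 0 := zpow_ne_zero _ hq
      generalize q ^ k = K at *
      rw [eq_inv_mul_iff_mul_eq₀ (mul_ne_zero e1 e2)]
      field_simp
      ring
    · rw [Finset.prod_range_succ, Finset.prod_range_succ, mul_add, mul_one, qfac,
        Finset.prod_range_succ, Finset.prod_range_succ, ← qfac]
      rw [← pow_succ', ← pow_succ']
      field_simp
      ring

/-- The **Jacobi triple product identity**. -/
theorem theta_eq_prod {q x : ℂ} (hq : q ≠ 0) (hq1 : ‖q‖ < 1) (hx : x ≠ 0) :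
    theta q x = poch q x * poch q (q / x) * poch q q := by
  have hE := poch_self_ne_zero hq1
  have hinv : Tendsto (fun n : ℕ => (qfac q n)⁻¹) atTop (𝓝 (poch q q)⁻¹) :=
    (tendsto_poch hq1 q).inv₀ hE
  obtain ⟨C, hC⟩ : ∃ C, ∀ m, ‖invQfac q m‖ ≤ C := by
    obtain ⟨C, hC⟩ := (Metric.isBounded_range_of_tendsto _ hinv).exists_norm_le
    refine ⟨max C 0, fun m => ?_⟩
    unfold invQfac
    split_ifs
    · exact (hC _ ⟨_, rfl⟩).trans (le_max_left _ _)
    · simp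
  have hC0 : 0 ≤ C := (norm_nonneg _).trans (hC 0)
  have hlim : Tendsto (fun n : ℕ => ∑' k : ℤ, thetaTerm q x k *
      (invQfac q (n + k) * invQfac q (n - k))) atTop
      (𝓝 (∑' k : ℤ, thetaTerm q x k * ((poch q q)⁻¹ * (poch q q)⁻¹))) := by
    refine tendsto_tsum_of_dominated_convergence (bound := fun k => ‖thetaTerm q x k‖ * (C * C))
      ((summable_thetaTerm hq hq1 hx).norm.mul_right _) (fun k => ?_)
      (Eventually.of_forall fun n k => ?_)
    · refine Tendsto.const_mul _ (Tendsto.mul ?_ ?_)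
      · have h : Tendsto (fun n : ℕ => ((n : ℤ) + k).toNat) atTop atTop :=
          tendsto_atTop.2 fun b => eventually_atTop.2 ⟨(b - k).toNat, fun n hn => by omega⟩
        refine (hinv.comp h).congr' (eventually_atTop.2 ⟨(-k).toNat, fun n hn => ?_⟩)
        simp only [Function.comp_apply, invQfac]
        exact (if_pos (by omega)).symm
      · have h : Tendsto (fun n : ℕ => ((n : ℤ) - k).toNat) atTop atTop :=
          tendsto_atTop.2 fun b => eventually_atTop.2 ⟨(b + k).toNat, fun n hn => by omega⟩
        refine (hinv.comp h).congr' (eventually_atTop.2 ⟨k.toNat, fun n hn => ?_⟩)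
        simp only [Function.comp_apply, invQfac]
        exact (if_pos (by omega)).symm
    · rw [norm_mul, norm_mul]
      gcongr <;> exact hC _
  have hlim2 := ((tendsto_poch hq1 x).mul (tendsto_poch hq1 (q / x))).mul
    (hinv.comp (tendsto_id.const_mul_atTop' (show 0 < 2 by norm_num)))
  have := tendsto_nhds_unique hlim (hlim2.congr fun n =>
    (hasSum_finite_triple hq hq1 hx n).tsum_eq.symm)
  rw [tsum_mul_right] at this
  change theta q x * _ = _ at this
  field_simp at this
  linear_combination this

lemma norm_pow_lt_one {q : ℂ} (hq1 : ‖q‖ < 1) {m : ℕ} (hm : m ≠ 0) : ‖q ^ m‖ < 1 := by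
  rw [norm_pow]; exact pow_lt_one₀ (norm_nonneg _) hq1 hm

lemma prod_range_mul_eq {M : Type*} [CommMonoid M] (f : ℕ → M) (m N : ℕ) :
    ∏ n ∈ Finset.range (m * N), f n =
      ∏ j ∈ Finset.range m, ∏ i ∈ Finset.range N, f (m * i + j) := by
  rw [Finset.prod_comm]
  induction N with
  | zero => simp
  | succ N ih => rw [mul_add, mul_one, Finset.prod_range_add, ih, Finset.prod_range_succ]

lemma poch_eq_prod_poch_pow {q : ℂ} (hq1 : ‖q‖ < 1) (x : ℂ) {m : ℕ} (hm : m ≠ 0) :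
    poch q x = ∏ j ∈ Finset.range m, poch (q ^ m) (x * q ^ j) := by
  have h1 := (tendsto_poch hq1 x).comp
    (tendsto_id.const_mul_atTop' (Nat.pos_of_ne_zero hm))
  refine tendsto_nhds_unique h1 ((tendsto_finsetProd (Finset.range m) fun j _ =>
    tendsto_poch (norm_pow_lt_one hq1 hm) (x * q ^ j)).congr fun N => ?_)
  rw [Function.comp_apply, id, prod_range_mul_eq]
  refine Finset.prod_congr rfl fun j _ => Finset.prod_congr rfl fun i _ => ?_
  rw [← pow_mul, pow_add]; ring

lemma prod_one_sub_root_mul {ζ : ℂ} {m : ℕ} (hm : 0 < m) (hζ : IsPrimitiveRoot ζ m) (y : ℂ) :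
    ∏ k ∈ Finset.range m, (1 - ζ ^ k * y) = 1 - y ^ m := by
  have h := congrArg (Polynomial.eval 1) (X_pow_sub_C_eq_prod hζ hm (rfl : y ^ m = y ^ m))
  simpa [Polynomial.eval_prod] using h.symm

lemma prod_poch_root_mul {q ζ : ℂ} (hq1 : ‖q‖ < 1) {m : ℕ} (hm : 0 < m)
    (hζ : IsPrimitiveRoot ζ m) (x : ℂ) :
    ∏ k ∈ Finset.range m, poch q (ζ ^ k * x) = poch (q ^ m) (x ^ m) := by
  refine tendsto_nhds_unique (tendsto_finsetProd (Finset.range m) fun k _ =>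
    tendsto_poch hq1 (ζ ^ k * x)) ((tendsto_poch (norm_pow_lt_one hq1 hm.ne') (x ^ m)).congr
      fun N => ?_)
  rw [Finset.prod_comm]
  refine Finset.prod_congr rfl fun i _ => ?_
  rw [← pow_mul, mul_comm m i, pow_mul, ← mul_pow, ← prod_one_sub_root_mul hm hζ]
  simp only [mul_assoc]

lemma theta_cube_self {q : ℂ} (hq : q ≠ 0) (hq1 : ‖q‖ < 1) : theta (q ^ 3) q = poch q q := by
  rw [theta_eq_prod (pow_ne_zero 3 hq) (norm_pow_lt_one hq1 (by norm_num : 3 ≠ 0)) hq,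
    poch_eq_prod_poch_pow hq1 q (by norm_num : 3 ≠ 0),
    Finset.prod_range_succ, Finset.prod_range_succ, Finset.prod_range_succ, Finset.prod_range_zero]
  rw [show q ^ 3 / q = q * q ^ 1 by field_simp]
  ring_nf

lemma theta_cube_sq {q : ℂ} (hq : q ≠ 0) (hq1 : ‖q‖ < 1) :
    theta (q ^ 3) (q ^ 2) = poch q q := by
  rw [← theta_cube_self hq hq1, ← theta_div (pow_ne_zero 3 hq) hq]
  congr 1
  field_simp

/-- The product of a theta function over a coset of the cube roots of unity. -/
lemma theta_mul_theta_mul_theta {q ω b : ℂ} (hq : q ≠ 0) (hq1 : ‖q‖ < 1)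
    (hω : IsPrimitiveRoot ω 3) (hb : b ≠ 0) :
    theta q b * theta q (ω * b) * theta q (ω ^ 2 * b) * poch (q ^ 3) (q ^ 3) =
      poch q q ^ 3 * theta (q ^ 3) (b ^ 3) := by
  have hω0 : ω ≠ 0 := hω.ne_zero (by norm_num)
  have h3 := hω.pow_eq_one
  have h1 := prod_poch_root_mul hq1 (by norm_num : 0 < 3) hω b
  have h2 := prod_poch_root_mul hq1 (by norm_num : 0 < 3) hω (q / b)
  simp only [Finset.prod_range_succ, Finset.prod_range_zero, pow_zero, one_mul, pow_one] at h1 h2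
  rw [theta_eq_prod (pow_ne_zero 3 hq) (norm_pow_lt_one hq1 (by norm_num : 3 ≠ 0)) (pow_ne_zero 3 hb),
    theta_eq_prod hq hq1 hb, theta_eq_prod hq hq1 (mul_ne_zero hω0 hb),
    theta_eq_prod hq hq1 (mul_ne_zero (pow_ne_zero 2 hω0) hb), ← div_pow, ← h1, ← h2,
    show q / (ω * b) = ω ^ 2 * (q / b) by field_simp; linear_combination -h3,
    show q / (ω ^ 2 * b) = ω * (q / b) by field_simp; linear_combination -h3]
  ring

lemma theta_cube_root {q ω : ℂ} (hq : q ≠ 0) (hq1 : ‖q‖ < 1) (hω : IsPrimitiveRoot ω 3) :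
    theta q ω = (1 - ω) * poch (q ^ 3) (q ^ 3) := by
  have hω0 : ω ≠ 0 := hω.ne_zero (by norm_num)
  have h3 := hω.pow_eq_one
  rw [theta_eq_prod hq hq1 hω0, ← prod_poch_root_mul hq1 (by norm_num : 0 < 3) hω q,
    poch_eq_one_sub_mul hq1 ω,
    show q / ω = ω ^ 2 * q by field_simp; linear_combination -h3]
  simp only [Finset.prod_range_succ, Finset.prod_range_zero, pow_zero, one_mul, pow_one]
  ring

lemma prod_theta_eleventh_root {q ζ : ℂ} (hq : q ≠ 0) (hq1 : ‖q‖ < 1)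
    (hζ : IsPrimitiveRoot ζ 11) :
    theta q ζ * theta q (ζ ^ 2) * theta q (ζ ^ 3) * theta q (ζ ^ 5) * theta q (ζ ^ 7) =
      (1 - ζ) * (1 - ζ ^ 2) * (1 - ζ ^ 3) * (1 - ζ ^ 5) * (1 - ζ ^ 7) * poch q q ^ 4 *
        poch (q ^ 11) (q ^ 11) := by
  have h0 : ζ ≠ 0 := hζ.ne_zero (by norm_num)
  have h11 := hζ.pow_eq_one
  have h := prod_poch_root_mul hq1 (by norm_num) hζ q
  simp only [Finset.prod_range_succ, Finset.prod_range_zero, pow_zero, one_mul, pow_one] at h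
  have e (k l : ℕ) (hkl : k + l = 11) : q / ζ ^ k = ζ ^ l * q := by
    rw [div_eq_iff (pow_ne_zero k h0), mul_right_comm, ← pow_add, add_comm l, hkl, h11, one_mul]
  have t (k l : ℕ) (hkl : k + l = 11) : theta q (ζ ^ k) =
      (1 - ζ ^ k) * poch q (ζ ^ k * q) * poch q (ζ ^ l * q) * poch q q := by
    rw [theta_eq_prod hq hq1 (pow_ne_zero k h0), poch_eq_one_sub_mul hq1 (ζ ^ k), e k l hkl]
  have t1 := t 1 10 rfl
  rw [pow_one] at t1
  rw [t1, t 2 9 rfl, t 3 8 rfl, t 5 6 rfl, t 7 4 rfl, ← h]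
  ring

lemma prod_theta_pow_eleven {q : ℂ} (hq : q ≠ 0) (hq1 : ‖q‖ < 1) :
    theta (q ^ 11) q * theta (q ^ 11) (q ^ 2) * theta (q ^ 11) (q ^ 3) * theta (q ^ 11) (q ^ 4) *
      theta (q ^ 11) (q ^ 5) = poch (q ^ 11) (q ^ 11) ^ 4 * poch q q := by
  have h11 := norm_pow_lt_one hq1 (show 11 ≠ 0 by norm_num)
  have h := poch_eq_prod_poch_pow hq1 q (show 11 ≠ 0 by norm_num)
  simp only [Finset.prod_range_succ, Finset.prod_range_zero, one_mul, ← pow_succ', zero_add,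
    pow_one] at h
  have t (k l : ℕ) (hkl : k + l = 11) : theta (q ^ 11) (q ^ k) =
      poch (q ^ 11) (q ^ k) * poch (q ^ 11) (q ^ l) * poch (q ^ 11) (q ^ 11) := by
    rw [theta_eq_prod (pow_ne_zero _ hq) h11 (pow_ne_zero k hq), ← hkl, pow_add,
      mul_div_cancel_left₀ _ (pow_ne_zero k hq)]
  have t1 := t 1 10 rfl
  rw [pow_one] at t1
  rw [t1, t 2 9 rfl, t 3 8 rfl, t 4 7 rfl, t 5 6 rfl, h]
  ring

lemma theta_neg_one_ne_zero {q : ℂ} (hq : q ≠ 0) (hq1 : ‖q‖ < 1) : theta q (-1) ≠ 0 := by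
  rw [theta_eq_prod hq hq1 (by norm_num), poch_eq_one_sub_mul hq1]
  have h : ‖-q‖ < 1 := by rwa [norm_neg]
  have := poch_ne_zero hq1 (one_sub_mul_pow_ne_zero hq1 h)
  rw [neg_one_mul, div_neg, div_one]
  exact mul_ne_zero (mul_ne_zero (mul_ne_zero (by norm_num) this) this) (poch_self_ne_zero hq1)

/-- The shear used to collect the terms of a product of three theta series. -/
def tripleShear : (Fin 3 × ℤ) × (ℤ × ℤ) ≃ ℤ × (ℤ × ℤ) :=
  (Equiv.prodCongr ((Equiv.prodComm _ _).trans (Int.divModEquiv 3).symm) (Equiv.refl _)).trans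
  { toFun := fun z => (z.1 - z.2.1 - z.2.2 - 2 * (z.1 / 3), z.1 / 3 + z.2.1, z.1 / 3 + z.2.2)
    invFun := fun z => (z.1 + z.2.1 + z.2.2, z.2.1 - (z.1 + z.2.1 + z.2.2) / 3,
      z.2.2 - (z.1 + z.2.1 + z.2.2) / 3)
    left_inv := fun ⟨s, m, n⟩ => by
      have h : s - m - n - 2 * (s / 3) + (s / 3 + m) + (s / 3 + n) = s := by ring
      simp [h]
    right_inv := fun ⟨l, m, n⟩ => by
      ext <;> simp; ring }

lemma tripleShear_apply (r : Fin 3) (M m n : ℤ) :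
    tripleShear ((r, M), (m, n)) = (M + r - m - n, M + m, M + n) := by
  have h : (M * 3 + (r : ℤ)) / 3 = M := by omega
  simp [tripleShear, h]
  ring

/-- The coefficient series in the expansion of `theta q a * theta q (a * b) * theta q (a / b)`. -/
def tripleCoeffTerm (q b : ℂ) (r : ℤ) (z : ℤ × ℤ) : ℂ :=
  q ^ (tri (r - z.1 - z.2) + tri z.1 + tri z.2) * b ^ (z.1 - z.2)

/-- The sum of `tripleCoeffTerm`. -/
def tripleCoeff (q b : ℂ) (r : ℤ) : ℂ := ∑' z, tripleCoeffTerm q b r z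

lemma thetaTerm_mul_mul {q a b : ℂ} (hq : q ≠ 0) (ha : a ≠ 0) (hb : b ≠ 0) (r M m n : ℤ) :
    thetaTerm q a (M + r - m - n) * (thetaTerm q (a * b) (M + m) * thetaTerm q (a / b) (M + n)) =
      ((-a) ^ r * thetaTerm (q ^ 3) (q ^ r * a ^ 3) M) * tripleCoeffTerm q b r (m, n) := by
  have h1 : (-1 : ℂ) ≠ 0 := by norm_num
  have e1 : (-1 : ℂ) ^ (M + r - m - n) * (-1) ^ (M + m) * (-1) ^ (M + n) = (-1) ^ r * (-1) ^ M := by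
    rw [← zpow_add₀ h1, ← zpow_add₀ h1, ← zpow_add₀ h1,
      show M + r - m - n + (M + m) + (M + n) = r + M + 2 * M by ring, zpow_add₀ h1 (r + M), zpow_mul]
    norm_num
  have e2 : tri (M + r - m - n) + tri (M + m) + tri (M + n) =
      3 * tri M + r * M + (tri (r - m - n) + tri m + tri n) := by
    rw [show M + r - m - n = M + (r - m - n) by ring, tri_add, tri_add M m, tri_add M n]
    ring
  have e3 : a ^ (M + r - m - n) * (a * b) ^ (M + m) * (a / b) ^ (M + n) =
      a ^ r * (a ^ 3) ^ M * b ^ (m - n) := by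
    rw [mul_zpow, div_zpow, div_eq_mul_inv, ← zpow_neg, ← zpow_natCast a 3, ← zpow_mul]
    have : a ^ (M + r - m - n) * (a ^ (M + m) * b ^ (M + m)) * (a ^ (M + n) * b ^ (-(M + n))) =
      (a ^ (M + r - m - n) * a ^ (M + m) * a ^ (M + n)) * (b ^ (M + m) * b ^ (-(M + n))) := by ring
    rw [this, ← zpow_add₀ ha, ← zpow_add₀ ha, ← zpow_add₀ ha, ← zpow_add₀ hb]
    push_cast
    congr 2 <;> ring
  have e4 : q ^ tri (M + r - m - n) * q ^ tri (M + m) * q ^ tri (M + n) =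
      (q ^ 3) ^ tri M * (q ^ r) ^ M * q ^ (tri (r - m - n) + tri m + tri n) := by
    rw [← zpow_add₀ hq, ← zpow_add₀ hq, e2, zpow_add₀ hq, zpow_add₀ hq (3 * tri M), zpow_mul,
      zpow_mul]
    norm_cast
  simp only [thetaTerm, tripleCoeffTerm]
  rw [neg_eq_neg_one_mul a, mul_zpow (-1) a, mul_zpow (q ^ r)]
  linear_combination e1 * (q ^ tri (M + r - m - n) * q ^ tri (M + m) * q ^ tri (M + n)) *
    (a ^ (M + r - m - n) * (a * b) ^ (M + m) * (a / b) ^ (M + n)) + (-1) ^ r * (-1) ^ M * e4 *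
    (a ^ (M + r - m - n) * (a * b) ^ (M + m) * (a / b) ^ (M + n)) + (-1) ^ r * (-1) ^ M *
    ((q ^ 3) ^ tri M * (q ^ r) ^ M * q ^ (tri (r - m - n) + tri m + tri n)) * e3

lemma hasSum_mul_of_norm {R ι κ : Type*} [NormedRing R] [CompleteSpace R] {f : ι → R} {g : κ → R}
    {a b : R} (hf : HasSum f a) (hg : HasSum g b) (hf' : Summable fun x => ‖f x‖)
    (hg' : Summable fun x => ‖g x‖) :
    HasSum (fun z : ι × κ => f z.1 * g z.2) (a * b) :=
  hf.mul hg (summable_mul_of_summable_norm hf' hg')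

lemma hasSum_mul_mul {R ι : Type*} [NormedRing R] [CompleteSpace R] {f g h : ι → R} {a b c : R}
    (hf : HasSum f a) (hg : HasSum g b) (hh : HasSum h c) (hf' : Summable fun x => ‖f x‖)
    (hg' : Summable fun x => ‖g x‖) (hh' : Summable fun x => ‖h x‖) :
    HasSum (fun z : ι × (ι × ι) => f z.1 * (g z.2.1 * h z.2.2)) (a * (b * c)) :=
  hasSum_mul_of_norm (g := fun z : ι × ι => g z.1 * h z.2) hf (hasSum_mul_of_norm hg hh hg' hh') hf'
    (hg'.mul_norm hh')

lemma hasSum_theta_triple {q a b : ℂ} (hq : q ≠ 0) (hq1 : ‖q‖ < 1) (ha : a ≠ 0) (hb : b ≠ 0) :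
    HasSum (fun z : (Fin 3 × ℤ) × (ℤ × ℤ) => ((-a) ^ (z.1.1 : ℤ) *
      thetaTerm (q ^ 3) (q ^ (z.1.1 : ℤ) * a ^ 3) z.1.2) * tripleCoeffTerm q b z.1.1 z.2)
      (theta q a * (theta q (a * b) * theta q (a / b))) := by
  have hs := hasSum_mul_mul (hasSum_theta hq hq1 ha) (hasSum_theta hq hq1 (mul_ne_zero ha hb))
    (hasSum_theta hq hq1 (div_ne_zero ha hb)) (summable_thetaTerm hq hq1 ha).norm
    (summable_thetaTerm hq hq1 (mul_ne_zero ha hb)).norm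
    (summable_thetaTerm hq hq1 (div_ne_zero ha hb)).norm
  refine hasSum_of_eq (tripleShear.hasSum_iff.2 hs) (fun z => ?_) rfl
  obtain ⟨⟨r, M⟩, ⟨m, n⟩⟩ := z
  rw [Function.comp_apply, tripleShear_apply]
  exact (thetaTerm_mul_mul hq ha hb r M m n).symm

lemma hasSum_fst_of_prod_mul {ι κ : Type*} {A : ι → ℂ} {B : ι → κ → ℂ} {s : ℂ}
    (hs : HasSum (fun z : ι × κ => A z.1 * B z.1 z.2) s) :
    HasSum (fun i => A i * ∑' k, B i k) s := by
  refine hs.prod_fiberwise fun i => ?_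
  rw [← tsum_mul_left]
  exact (hs.summable.prod_factor i).hasSum

lemma hasSum_eq_sum_of_prod_mul {ι κ : Type*} [Fintype ι] {A : ι → κ → ℂ} {B a : ι → ℂ} {s : ℂ}
    (hs : HasSum (fun z : ι × κ => A z.1 z.2 * B z.1) s) (h : ∀ i, HasSum (A i) (a i)) :
    s = ∑ i, a i * B i :=
  (hs.prod_fiberwise fun i => (h i).mul_right (B i)).unique (hasSum_fintype _)

lemma theta_triple_expansion {q a b : ℂ} (hq : q ≠ 0) (hq1 : ‖q‖ < 1) (ha : a ≠ 0) (hb : b ≠ 0) :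
    theta q a * (theta q (a * b) * theta q (a / b)) =
      ∑ r : Fin 3, (-a) ^ (r : ℤ) * theta (q ^ 3) (q ^ (r : ℤ) * a ^ 3) * tripleCoeff q b r := by
  have hs := hasSum_fst_of_prod_mul (A := fun z : Fin 3 × ℤ => (-a) ^ (z.1 : ℤ) *
      thetaTerm (q ^ 3) (q ^ (z.1 : ℤ) * a ^ 3) z.2) (B := fun z => tripleCoeffTerm q b z.1)
      (hasSum_theta_triple hq hq1 ha hb)
  exact hasSum_eq_sum_of_prod_mul (A := fun (r : Fin 3) M => (-a) ^ (r : ℤ) *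
      thetaTerm (q ^ 3) (q ^ (r : ℤ) * a ^ 3) M) (B := fun r => tripleCoeff q b r) hs fun r =>
    (hasSum_theta (pow_ne_zero 3 hq) (norm_pow_lt_one hq1 (by norm_num : 3 ≠ 0))
      (mul_ne_zero (zpow_ne_zero _ hq) (pow_ne_zero 3 ha))).mul_left _

lemma tripleCoeff_two (q b : ℂ) : tripleCoeff q b 2 = tripleCoeff q b 1 := by
  let e : ℤ × ℤ ≃ ℤ × ℤ := (Equiv.prodComm _ _).trans
    (Equiv.prodCongr (Equiv.subLeft (1 : ℤ)) (Equiv.subLeft (1 : ℤ)))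
  rw [tripleCoeff, tripleCoeff, ← e.tsum_eq]
  refine tsum_congr fun ⟨m, n⟩ => ?_
  simp only [tripleCoeffTerm, e, Equiv.trans_apply, Equiv.prodComm_apply, Prod.swap,
    Equiv.prodCongr_apply, Prod.map, Equiv.subLeft_apply]
  rw [tri_one_sub, tri_one_sub, show (2 : ℤ) - (1 - n) - (1 - m) = 1 - (1 - m - n) by ring,
    tri_one_sub, add_right_comm]
  congr 2; ring

/-- The first of the two theta functions in Winquist's identity. -/
def winqA (q a : ℂ) : ℂ := theta (q ^ 3) (a ^ 3)

/-- The second of the two theta functions in Winquist's identity. -/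
def winqB (q a : ℂ) : ℂ :=
  a ^ 2 * theta (q ^ 3) (q ^ 2 * a ^ 3) - a * theta (q ^ 3) (q * a ^ 3)

lemma theta_triple {q a b : ℂ} (hq : q ≠ 0) (hq1 : ‖q‖ < 1) (ha : a ≠ 0) (hb : b ≠ 0) :
    theta q a * theta q (a * b) * theta q (a / b) =
      winqA q a * tripleCoeff q b 0 + winqB q a * tripleCoeff q b 1 := by
  rw [mul_assoc, theta_triple_expansion hq hq1 ha hb, Fin.sum_univ_three]
  have := tripleCoeff_two q b
  simp [winqA, winqB, this]
  ring

lemma primitive_cube : ∃ ω : ℂ, IsPrimitiveRoot ω 3 :=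
  ⟨_, Complex.isPrimitiveRoot_exp 3 (by norm_num)⟩

lemma mul_theta_mul_tripleCoeff {q b : ℂ} (hq : q ≠ 0) (hq1 : ‖q‖ < 1) (hb : b ≠ 0) :
    b * theta q b * tripleCoeff q b 1 = poch q q ^ 2 * winqA q b := by
  obtain ⟨ω, hω⟩ := primitive_cube
  have hω0 : ω ≠ 0 := hω.ne_zero (by norm_num)
  have h3 := hω.pow_eq_one
  have h1 : ω ≠ 1 := hω.ne_one (by norm_num)
  have hE := poch_self_ne_zero hq1
  have hE3 := poch_self_ne_zero (norm_pow_lt_one hq1 (by norm_num : 3 ≠ 0))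
  have hp := theta_mul_theta_mul_theta hq hq1 hω hb
  have ht := theta_triple hq hq1 hω0 hb
  have hd : theta q (ω / b) = -(ω / b) * theta q (ω ^ 2 * b) := by
    have := theta_inv (q := q) (div_ne_zero hω0 hb)
    rw [show (ω / b)⁻¹ = ω ^ 2 * b by field_simp; linear_combination -h3] at this
    rw [this]; field_simp
  have hA : winqA q ω = 0 := by rw [winqA, h3, theta_one]
  have hB : winqB q ω = (ω ^ 2 - ω) * poch q q := by
    rw [winqB, h3, mul_one, mul_one, theta_cube_self hq hq1, theta_cube_sq hq hq1]; ring
  rw [hA, hB, theta_cube_root hq hq1 hω, hd] at ht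
  have hne : (ω ^ 2 - ω) * poch q q ≠ 0 := by
    refine mul_ne_zero ?_ hE
    rw [show ω ^ 2 - ω = ω * (ω - 1) by ring]
    exact mul_ne_zero hω0 (sub_ne_zero.2 h1)
  refine mul_left_cancel₀ hne ?_
  field_simp at ht
  rw [winqA]
  linear_combination (ω ^ 2 - ω) * hp - theta q b * ht

/-- **Winquist's identity**. -/
theorem winquist {q a b : ℂ} (hq : q ≠ 0) (hq1 : ‖q‖ < 1) (ha : a ≠ 0) (hb : b ≠ 0) :
    b * theta q a * theta q b * theta q (a * b) * theta q (a / b) =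
      poch q q ^ 2 * (winqB q a * winqA q b - winqA q a * winqB q b) := by
  set P : ℂ → ℂ := fun b => b * theta q b * tripleCoeff q b 0 with hP
  set R : ℂ → ℂ := fun b => P b + poch q q ^ 2 * winqB q b with hR
  have key : ∀ a b : ℂ, a ≠ 0 → b ≠ 0 →
      b * theta q a * theta q b * theta q (a * b) * theta q (a / b) =
        winqA q a * P b + poch q q ^ 2 * winqB q a * winqA q b := fun a b ha hb => by
    linear_combination b * theta q b * theta_triple hq hq1 ha hb +
      winqB q a * mul_theta_mul_tripleCoeff hq hq1 hb
  have anti : ∀ a b : ℂ, a ≠ 0 → b ≠ 0 → winqA q a * R b + winqA q b * R a = 0 :=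
    fun a b ha hb => by
      have h1 := key a b ha hb
      have h2 := key b a hb ha
      have h3 := theta_inv (q := q) (div_ne_zero ha hb)
      rw [inv_div] at h3
      rw [h3, mul_comm b a] at h2
      field_simp at h2
      simp only [hR]
      linear_combination -h1 - h2
  have hsq : ∀ a : ℂ, a ≠ 0 → winqA q a * R a = 0 := fun a ha => by
    linear_combination anti a a ha ha / 2
  have hA : winqA q (-1) ≠ 0 := by
    rw [winqA, show (-1 : ℂ) ^ 3 = -1 by norm_num]
    exact theta_neg_one_ne_zero (pow_ne_zero 3 hq) (norm_pow_lt_one hq1 (by norm_num))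
  have hR1 : R (-1) = 0 := (mul_eq_zero.1 (hsq _ (by norm_num))).resolve_left hA
  have hRb : R b = 0 := by
    have := anti (-1) b (by norm_num) hb
    rw [hR1, mul_zero, add_zero] at this
    exact (mul_eq_zero.1 this).resolve_left hA
  rw [key a b ha hb]
  linear_combination winqA q a * hRb

lemma winqA_inv {q y : ℂ} (hy : y ≠ 0) : winqA q y⁻¹ = -winqA q y / y ^ 3 := by
  rw [winqA, winqA, inv_pow, theta_inv (pow_ne_zero 3 hy)]

lemma winqB_inv {q y : ℂ} (hq : q ≠ 0) (hy : y ≠ 0) : winqB q y⁻¹ = -winqB q y / y ^ 3 := by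
  have hq3 := pow_ne_zero 3 hq
  have h1 := theta_div hq3 (mul_ne_zero hq (pow_ne_zero 3 hy))
  have h2 := theta_div hq3 (mul_ne_zero (pow_ne_zero 2 hq) (pow_ne_zero 3 hy))
  rw [show q ^ 3 / (q * y ^ 3) = q ^ 2 * y⁻¹ ^ 3 by field_simp] at h1
  rw [show q ^ 3 / (q ^ 2 * y ^ 3) = q * y⁻¹ ^ 3 by field_simp] at h2
  rw [winqB, winqB, h1, h2]
  field_simp
  ring

/-- The weights occurring in the dissection of `winqA` and `winqB`. -/
def dissWeight (q x : ℂ) (c : ℤ) : ℂ := (-1) ^ (c - 5) * q ^ (3 * tri (c - 5)) * x ^ (3 * c - 4)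

lemma winqA_dissection {q x : ℂ} (hq : q ≠ 0) (hq1 : ‖q‖ < 1) (hx : x ^ 11 = 1) :
    winqA q x = ∑ s : Fin 11,
      dissWeight q x ((s : ℤ) - 5) * winqA (q ^ 121) (q ^ (11 * ((s : ℤ) - 5))) := by
  have hx0 : x ≠ 0 := by rintro rfl; norm_num at hx
  rw [winqA, theta_split (pow_ne_zero 3 hq) (norm_pow_lt_one hq1 (by norm_num))
    (pow_ne_zero 3 hx0) (-10)]
  refine Finset.sum_congr rfl fun s _ => ?_
  obtain ⟨c, hc⟩ : ∃ c : ℤ, c = s - 5 := ⟨_, rfl⟩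
  have e : (x ^ 3) ^ (c - 5) = x ^ (3 * c - 4) := by
    rw [← zpow_natCast x 3, ← zpow_mul, show ((3 : ℕ) : ℤ) * (c - 5) =
      3 * c - 4 + (11 : ℕ) * (-1) by push_cast; ring, zpow_add₀ hx0, zpow_mul,
      zpow_natCast, hx]
    simp
  have a : (q ^ 3) ^ (11 * (c - 5 + 5)) * (x ^ 3) ^ 11 = (q ^ (11 * c)) ^ 3 := by
    rw [← pow_mul x, mul_comm 3 11, pow_mul, hx, one_pow, mul_one]
    simp only [← zpow_natCast, ← zpow_mul]
    push_cast; ring_nf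
  rw [← hc, show (-10 : ℤ) + s = c - 5 by omega, winqA, thetaTerm, dissWeight, e, a, ← pow_mul,
    ← pow_mul, mul_comm 3 121, zpow_mul q 3]
  norm_cast

lemma winqB_dissection {q x : ℂ} (hq : q ≠ 0) (hq1 : ‖q‖ < 1) (hx : x ^ 11 = 1) :
    q ^ 40 * winqB q x = ∑ s : Fin 11,
      dissWeight q x ((s : ℤ) - 5) * winqB (q ^ 121) (q ^ (11 * ((s : ℤ) - 5))) := by
  have hx0 : x ≠ 0 := by rintro rfl; norm_num at hx
  have hq3 := pow_ne_zero 3 hq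
  have hq31 := norm_pow_lt_one hq1 (by norm_num : 3 ≠ 0)
  rw [winqB, theta_split hq3 hq31 (mul_ne_zero (pow_ne_zero 2 hq) (pow_ne_zero 3 hx0)) (-7),
    theta_split hq3 hq31 (mul_ne_zero hq (pow_ne_zero 3 hx0)) (-3), Finset.mul_sum, Finset.mul_sum,
    ← Finset.sum_sub_distrib, Finset.mul_sum]
  refine Finset.sum_congr rfl fun s _ => ?_
  obtain ⟨c, hc⟩ : ∃ c : ℤ, c = s - 5 := ⟨_, rfl⟩
  have h1 : (-1 : ℂ) ≠ 0 := by norm_num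
  rw [winqB, ← hc, show (-7 : ℤ) + s = c - 2 by omega, show (-3 : ℤ) + s = c + 2 by omega]
  have a1 : (q ^ 3) ^ (11 * (c - 2 + 5)) * (q ^ 2 * x ^ 3) ^ 11 =
      q ^ 121 * (q ^ (11 * c)) ^ 3 := by
    rw [mul_pow, ← pow_mul x, mul_comm 3 11, pow_mul, hx, one_pow, mul_one]
    simp only [← zpow_natCast, ← zpow_mul, ← zpow_add₀ hq]
    push_cast; ring_nf
  have a2 : (q ^ 3) ^ (11 * (c + 2 + 5)) * (q * x ^ 3) ^ 11 =
      (q ^ 121) ^ 2 * (q ^ (11 * c)) ^ 3 := by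
    rw [mul_pow, ← pow_mul x, mul_comm 3 11, pow_mul, hx, one_pow, mul_one]
    simp only [← zpow_natCast, ← zpow_mul, ← zpow_add₀ hq]
    push_cast; ring_nf
  have t1 : tri (c - 2) = tri (c - 5) + 3 * c - 12 := by
    rw [show c - 2 = c - 5 + 3 by ring, tri_add, show tri 3 = 3 from rfl]; ring
  have t2 : tri (c + 2) = tri (c - 5) + 7 * c - 14 := by
    rw [show c + 2 = c - 5 + 7 by ring, tri_add, show tri 7 = 21 from rfl]; ring
  have s1 : (-1 : ℂ) ^ (c - 2) = -(-1) ^ (c - 5) := by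
    rw [show c - 2 = c - 5 + 3 by ring, zpow_add₀ h1]; norm_num
  have s2 : (-1 : ℂ) ^ (c + 2) = -(-1) ^ (c - 5) := by
    rw [show c + 2 = c - 5 + 7 by ring, zpow_add₀ h1]; norm_num
  have b1 : q ^ 40 * (x ^ 2 * thetaTerm (q ^ 3) (q ^ 2 * x ^ 3) (c - 2)) =
      -(dissWeight q x c * q ^ (11 * c)) := by
    rw [thetaTerm, dissWeight, s1, mul_zpow, t1]
    have hxx : x ^ 2 * (x ^ 3) ^ (c - 2) = x ^ (3 * c - 4) := by
      simp only [← zpow_natCast, ← zpow_mul, ← zpow_add₀ hx0]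
      push_cast; ring_nf
    have hqq : q ^ 40 * ((q ^ 3) ^ (tri (c - 5) + 3 * c - 12) * (q ^ 2) ^ (c - 2)) =
        q ^ (3 * tri (c - 5)) * q ^ (11 * c) := by
      simp only [← zpow_natCast, ← zpow_mul, ← zpow_add₀ hq]
      push_cast; ring_nf
    linear_combination -(-1) ^ (c - 5) * x ^ (3 * c - 4) * hqq - (-1) ^ (c - 5) *
      q ^ 40 * ((q ^ 3) ^ (tri (c - 5) + 3 * c - 12) * (q ^ 2) ^ (c - 2)) * hxx
  have b2 : q ^ 40 * (x * thetaTerm (q ^ 3) (q * x ^ 3) (c + 2)) =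
      -(dissWeight q x c * (q ^ (11 * c)) ^ 2) := by
    rw [thetaTerm, dissWeight, s2, mul_zpow, t2]
    have hxx : x * (x ^ 3) ^ (c + 2) = x ^ (3 * c - 4) := by
      have : x * (x ^ 3) ^ (c + 2) = x ^ (3 * c - 4) * x ^ 11 := by
        simp only [← zpow_natCast, ← zpow_mul, ← zpow_add₀ hx0, ← zpow_one_add₀ hx0]
        push_cast; ring_nf
      rw [this, hx, mul_one]
    have hqq : q ^ 40 * ((q ^ 3) ^ (tri (c - 5) + 7 * c - 14) * q ^ (c + 2)) =
        q ^ (3 * tri (c - 5)) * (q ^ (11 * c)) ^ 2 := by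
      simp only [← zpow_natCast, ← zpow_mul, ← zpow_add₀ hq]
      push_cast; ring_nf
    linear_combination -(-1) ^ (c - 5) * x ^ (3 * c - 4) * hqq - (-1) ^ (c - 5) *
      q ^ 40 * ((q ^ 3) ^ (tri (c - 5) + 7 * c - 14) * q ^ (c + 2)) * hxx
  rw [a1, a2, ← pow_mul, mul_comm 3 121, pow_mul]
  linear_combination b1 * theta ((q ^ 121) ^ 3) (q ^ 121 * (q ^ (11 * c)) ^ 3) -
    b2 * theta ((q ^ 121) ^ 3) ((q ^ 121) ^ 2 * (q ^ (11 * c)) ^ 3)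

lemma dissWeight_neg {q x : ℂ} (hq : q ≠ 0) (c : ℤ) :
    dissWeight q x (-c) / (q ^ (11 * c)) ^ 3 =
      (-1) ^ (c - 5) * q ^ (3 * tri (c - 5)) * x ^ (-3 * c - 4) := by
  have h1 : (-1 : ℂ) ≠ 0 := by norm_num
  have t : tri (-c - 5) = tri (c - 5) + 11 * c := by
    rw [show -c - 5 = 1 - (c - 5 + 11) by ring, tri_one_sub, tri_add, show tri 11 = 55 from rfl]
    ring
  have s : (-1 : ℂ) ^ (-c - 5) = (-1) ^ (c - 5) := by
    rw [show c - 5 = -c - 5 + 2 * c by ring, zpow_add₀ h1, zpow_mul]; norm_num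
  rw [dissWeight, t, s, div_eq_iff (pow_ne_zero 3 (zpow_ne_zero _ hq)), mul_add, zpow_add₀ hq,
    ← zpow_natCast _ 3, ← zpow_mul, show 3 * (11 * c) = 11 * c * (3 : ℕ) by push_cast; ring]
  ring_nf

lemma sum_dissWeight {q x : ℂ} (hq : q ≠ 0) (hx : x ^ 11 = 1) {F : ℂ → ℂ}
    (hF : ∀ y, y ≠ 0 → F y⁻¹ = -F y / y ^ 3) :
    ∑ s : Fin 11, dissWeight q x ((s : ℤ) - 5) * F (q ^ (11 * ((s : ℤ) - 5))) =
      q ^ 30 * (x ^ 10 - x ^ 4) * F (q ^ 11) - q ^ 18 * (x ^ 2 - x) * F (q ^ 22) +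
      q ^ 9 * (x ^ 5 - x ^ 9) * F (q ^ 33) - q ^ 3 * (x ^ 8 - x ^ 6) * F (q ^ 44) +
      (1 - x ^ 3) * F (q ^ 55) := by
  have hx0 : x ≠ 0 := by rintro rfl; norm_num at hx
  have hF1 : F 1 = 0 := by
    have := hF 1 one_ne_zero
    rw [inv_one, one_pow, div_one] at this
    linear_combination this / 2
  have key (c : ℤ) : dissWeight q x c * F (q ^ (11 * c)) + dissWeight q x (-c) * F (q ^ (11 * -c)) =
      (-1) ^ (c - 5) * q ^ (3 * tri (c - 5)) * (x ^ (3 * c - 4) - x ^ (-3 * c - 4)) *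
        F (q ^ (11 * c)) := by
    rw [mul_neg, zpow_neg, hF _ (zpow_ne_zero _ hq)]
    have hd : dissWeight q x c = (-1) ^ (c - 5) * q ^ (3 * tri (c - 5)) * x ^ (3 * c - 4) := rfl
    linear_combination F (q ^ (11 * c)) * hd - F (q ^ (11 * c)) * dissWeight_neg (x := x) hq c
  have hxn (a : ℤ) (n : ℕ) (k : ℤ) (h : a = n + 11 * k) : x ^ a = x ^ n := by
    rw [h, zpow_add₀ hx0, zpow_mul, show x ^ (11 : ℤ) = 1 by exact_mod_cast hx]; simp
  have k1 := key 1
  have k2 := key 2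
  have k3 := key 3
  have k4 := key 4
  have k5 := key 5
  rw [hxn _ 10 (-1) (by norm_num), hxn _ 4 (-1) (by norm_num)] at k1
  rw [hxn _ 2 0 (by norm_num), hxn _ 1 (-1) (by norm_num)] at k2
  rw [hxn _ 5 0 (by norm_num), hxn _ 9 (-2) (by norm_num)] at k3
  rw [hxn _ 8 0 (by norm_num), hxn _ 6 (-2) (by norm_num)] at k4
  rw [hxn _ 0 1 (by norm_num), hxn _ 3 (-2) (by norm_num)] at k5
  norm_num [tri] at k1 k2 k3 k4 k5
  norm_num [Fin.sum_univ_succ, hF1]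
  linear_combination k1 + k2 + k3 + k4 + k5

/-- The theta series `∑ (-1)^k q^(121k(k-1)/2 + 11mk)`. -/
def xTheta (q : ℂ) (m : ℕ) : ℂ := theta (q ^ 121) (q ^ (11 * m))

lemma xTheta_winquist {q : ℂ} (hq : q ≠ 0) (hq1 : ‖q‖ < 1) (c d m l c' d' : ℕ) (hc : c' = 11 * c)
    (hd : d' = 11 * d) (hm : c + d = m ∨ c + d + m = 11) (hl : l + d = c) :
    q ^ d' * xTheta q c * xTheta q d * xTheta q m * xTheta q l =
      poch (q ^ 121) (q ^ 121) ^ 2 *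
        (winqB (q ^ 121) (q ^ c') * winqA (q ^ 121) (q ^ d') -
          winqA (q ^ 121) (q ^ c') * winqB (q ^ 121) (q ^ d')) := by
  subst hc hd
  have hQ := pow_ne_zero 121 hq
  have hQ1 := norm_pow_lt_one hq1 (by norm_num : 121 ≠ 0)
  have e1 : theta (q ^ 121) (q ^ (11 * c) * q ^ (11 * d)) = xTheta q m := by
    rcases hm with rfl | hm
    · rw [xTheta, mul_add, pow_add]
    · rw [xTheta, ← theta_div hQ (pow_ne_zero (11 * m) hq), ← pow_add]
      congr 1
      rw [eq_div_iff (pow_ne_zero _ hq), ← pow_add]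
      congr 1
      omega
  have e2 : q ^ (11 * c) / q ^ (11 * d) = q ^ (11 * l) := by
    rw [div_eq_iff (pow_ne_zero _ hq), ← pow_add, ← hl, mul_add]
  rw [← winquist hQ hQ1 (pow_ne_zero (11 * c) hq) (pow_ne_zero (11 * d) hq), e1, e2]
  simp only [xTheta]

/-- The 11-dissection of the right hand side of Winquist's identity at 11th roots of unity. -/
lemma winquist_dissection {q u v : ℂ} (hq : q ≠ 0) (hq1 : ‖q‖ < 1) (hu : u ^ 11 = 1)
    (hv : v ^ 11 = 1) :
    poch (q ^ 121) (q ^ 121) ^ 2 * (winqB q u * winqA q v - winqA q u * winqB q v) =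
      - q ^ 19 * ((u ^ 2 - u) * (v ^ 10 - v ^ 4) - (u ^ 10 - u ^ 4) * (v ^ 2 - v)) *
        (xTheta q 2 * xTheta q 1 * xTheta q 3 * xTheta q 1)
      + q ^ 10 * ((u ^ 5 - u ^ 9) * (v ^ 10 - v ^ 4) - (u ^ 10 - u ^ 4) * (v ^ 5 - v ^ 9)) *
        (xTheta q 3 * xTheta q 1 * xTheta q 4 * xTheta q 2)
      - q ^ 9 * ((u ^ 5 - u ^ 9) * (v ^ 2 - v) - (u ^ 2 - u) * (v ^ 5 - v ^ 9)) *
        (xTheta q 3 * xTheta q 2 * xTheta q 5 * xTheta q 1)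
      - q ^ 4 * ((u ^ 8 - u ^ 6) * (v ^ 10 - v ^ 4) - (u ^ 10 - u ^ 4) * (v ^ 8 - v ^ 6)) *
        (xTheta q 4 * xTheta q 1 * xTheta q 5 * xTheta q 3)
      + q ^ 3 * ((u ^ 8 - u ^ 6) * (v ^ 2 - v) - (u ^ 2 - u) * (v ^ 8 - v ^ 6)) *
        (xTheta q 4 * xTheta q 2 * xTheta q 5 * xTheta q 2)
      - q ^ 5 * ((u ^ 8 - u ^ 6) * (v ^ 5 - v ^ 9) - (u ^ 5 - u ^ 9) * (v ^ 8 - v ^ 6)) *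
        (xTheta q 4 * xTheta q 3 * xTheta q 4 * xTheta q 1)
      + q ^ 1 * ((1 - u ^ 3) * (v ^ 10 - v ^ 4) - (u ^ 10 - u ^ 4) * (1 - v ^ 3)) *
        (xTheta q 5 * xTheta q 1 * xTheta q 5 * xTheta q 4)
      - q ^ 0 * ((1 - u ^ 3) * (v ^ 2 - v) - (u ^ 2 - u) * (1 - v ^ 3)) *
        (xTheta q 5 * xTheta q 2 * xTheta q 4 * xTheta q 3)
      + q ^ 2 * ((1 - u ^ 3) * (v ^ 5 - v ^ 9) - (u ^ 5 - u ^ 9) * (1 - v ^ 3)) *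
        (xTheta q 5 * xTheta q 3 * xTheta q 3 * xTheta q 2)
      - q ^ 7 * ((1 - u ^ 3) * (v ^ 8 - v ^ 6) - (u ^ 8 - u ^ 6) * (1 - v ^ 3)) *
        (xTheta q 5 * xTheta q 4 * xTheta q 2 * xTheta q 1) := by
  have hQ := pow_ne_zero 121 hq
  have hA : ∀ y : ℂ, y ≠ 0 → winqA (q ^ 121) y⁻¹ = -winqA (q ^ 121) y / y ^ 3 :=
    fun _ => winqA_inv
  have hB : ∀ y : ℂ, y ≠ 0 → winqB (q ^ 121) y⁻¹ = -winqB (q ^ 121) y / y ^ 3 :=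
    fun _ => winqB_inv hQ
  have Au := (winqA_dissection hq hq1 hu).trans (sum_dissWeight hq hu hA)
  have Av := (winqA_dissection hq hq1 hv).trans (sum_dissWeight hq hv hA)
  have Bu := (winqB_dissection hq hq1 hu).trans (sum_dissWeight hq hu hB)
  have Bv := (winqB_dissection hq hq1 hv).trans (sum_dissWeight hq hv hB)
  have w21 := xTheta_winquist hq hq1 2 1 3 1 22 11 rfl rfl (by norm_num) (by norm_num)
  have w31 := xTheta_winquist hq hq1 3 1 4 2 33 11 rfl rfl (by norm_num) (by norm_num)
  have w32 := xTheta_winquist hq hq1 3 2 5 1 33 22 rfl rfl (by norm_num) (by norm_num)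
  have w41 := xTheta_winquist hq hq1 4 1 5 3 44 11 rfl rfl (by norm_num) (by norm_num)
  have w42 := xTheta_winquist hq hq1 4 2 5 2 44 22 rfl rfl (by norm_num) (by norm_num)
  have w43 := xTheta_winquist hq hq1 4 3 4 1 44 33 rfl rfl (by norm_num) (by norm_num)
  have w51 := xTheta_winquist hq hq1 5 1 5 4 55 11 rfl rfl (by norm_num) (by norm_num)
  have w52 := xTheta_winquist hq hq1 5 2 4 3 55 22 rfl rfl (by norm_num) (by norm_num)
  have w53 := xTheta_winquist hq hq1 5 3 3 2 55 33 rfl rfl (by norm_num) (by norm_num)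
  have w54 := xTheta_winquist hq hq1 5 4 2 1 55 44 rfl rfl (by norm_num) (by norm_num)
  refine mul_left_cancel₀ (pow_ne_zero 40 hq) ?_
  have expand : q ^ 40 * (poch (q ^ 121) (q ^ 121) ^ 2 *
      (winqB q u * winqA q v - winqA q u * winqB q v)) = poch (q ^ 121) (q ^ 121) ^ 2 *
      ((q ^ 40 * winqB q u) * winqA q v - winqA q u * (q ^ 40 * winqB q v)) := by ring
  rw [expand, Au, Av, Bu, Bv]
  clear Au Av Bu Bv expand
  generalize winqA (q ^ 121) (q ^ 11) = a1 at *
  generalize winqA (q ^ 121) (q ^ 22) = a2 at *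
  generalize winqA (q ^ 121) (q ^ 33) = a3 at *
  generalize winqA (q ^ 121) (q ^ 44) = a4 at *
  generalize winqA (q ^ 121) (q ^ 55) = a5 at *
  generalize winqB (q ^ 121) (q ^ 11) = b1 at *
  generalize winqB (q ^ 121) (q ^ 22) = b2 at *
  generalize winqB (q ^ 121) (q ^ 33) = b3 at *
  generalize winqB (q ^ 121) (q ^ 44) = b4 at *
  generalize winqB (q ^ 121) (q ^ 55) = b5 at *
  generalize xTheta q 1 = x1 at *
  generalize xTheta q 2 = x2 at *
  generalize xTheta q 3 = x3 at *
  generalize xTheta q 4 = x4 at *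
  generalize xTheta q 5 = x5 at *
  generalize poch (q ^ 121) (q ^ 121) = e at *
  generalize u ^ 10 - u ^ 4 = u1
  generalize u ^ 2 - u = u2
  generalize u ^ 5 - u ^ 9 = u3
  generalize u ^ 8 - u ^ 6 = u4
  generalize 1 - u ^ 3 = u5
  generalize v ^ 10 - v ^ 4 = v1
  generalize v ^ 2 - v = v2
  generalize v ^ 5 - v ^ 9 = v3
  generalize v ^ 8 - v ^ 6 = v4
  generalize 1 - v ^ 3 = v5
  linear_combination q ^ 48 * (u2 * v1 - u1 * v2) * w21
    - q ^ 39 * (u3 * v1 - u1 * v3) * w31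
    + q ^ 27 * (u3 * v2 - u2 * v3) * w32
    + q ^ 33 * (u4 * v1 - u1 * v4) * w41
    - q ^ 21 * (u4 * v2 - u2 * v4) * w42
    + q ^ 12 * (u4 * v3 - u3 * v4) * w43
    - q ^ 30 * (u5 * v1 - u1 * v5) * w51
    + q ^ 18 * (u5 * v2 - u2 * v5) * w52
    - q ^ 9 * (u5 * v3 - u3 * v5) * w53
    + q ^ 3 * (u5 * v4 - u4 * v5) * w54

/-- The coefficient vectors of the dissection of the crank deviations, by residue class. -/
def dissCoeff : Fin 11 → Fin 10 → ℤ :=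
  ![![10, -12, -2, 8, 6, 4, -4, -6, -8, 2],
    ![-1, 10, -2, -3, -5, 4, 7, 5, 3, 2],
    ![-1, -1, 9, -3, 6, -7, -4, -6, 3, 2],
    ![-1, -1, -2, 8, -5, 4, -4, 5, 3, -9],
    ![-1, -1, -2, -3, 6, -7, 7, 5, -8, 2],
    ![-1, -1, -2, -3, -5, 4, -4, -6, 3, 2],
    ![-1, -1, -2, -3, -5, 4, -4, -6, 3, 2],
    ![-1, -1, -2, -3, 6, -7, 7, 5, -8, 2],
    ![-1, -1, -2, 8, -5, 4, -4, 5, 3, -9],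
    ![-1, -1, 9, -3, 6, -7, -4, -6, 3, 2],
    ![-1, 10, -2, -3, -5, 4, 7, 5, 3, 2]]

lemma dissCoeff_eval {z d : ℂ}
    (h : 1 + z + z ^ 2 + z ^ 3 + z ^ 4 + z ^ 5 + z ^ 6 + z ^ 7 + z ^ 8 + z ^ 9 + z ^ 10 = 0)
    (hd : d = (1 - z) * (1 - z ^ 2) * (1 - z ^ 3) * (1 - z ^ 5) * (1 - z ^ 7) * z ^ 2) :
    11 * (1 - z) * -((1 - z ^ 4) * (z ^ 4 - z ^ 2) -
      (z ^ 10 - z ^ 5) * (1 - z ^ 6)) =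
        d * ∑ a : Fin 11, (dissCoeff a 0 : ℂ) * z ^ (a : ℕ) ∧
    11 * (1 - z) * ((1 - z ^ 4) * (z ^ 9 - z ^ 8) -
      (z ^ 6 - z ^ 9) * (1 - z ^ 6)) =
        d * ∑ a : Fin 11, (dissCoeff a 1 : ℂ) * z ^ (a : ℕ) ∧
    11 * (1 - z) * ((1 - z ^ 4) * (z ^ 10 - z ^ 7) -
      (z ^ 3 - z) * (1 - z ^ 6)) =
        d * ∑ a : Fin 11, (dissCoeff a 2 : ℂ) * z ^ (a : ℕ) ∧
    11 * (1 - z) * ((z ^ 7 - z ^ 8) * (z ^ 4 - z ^ 2) -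
      (z ^ 10 - z ^ 5) * (z ^ 5 - z)) =
        d * ∑ a : Fin 11, (dissCoeff a 3 : ℂ) * z ^ (a : ℕ) ∧
    11 * (1 - z) * -((z ^ 7 - z ^ 8) * (z ^ 9 - z ^ 8) -
      (z ^ 6 - z ^ 9) * (z ^ 5 - z)) =
        d * ∑ a : Fin 11, (dissCoeff a 4 : ℂ) * z ^ (a : ℕ) ∧
    11 * (1 - z) * -((z ^ 7 - z ^ 8) * (z ^ 10 - z ^ 7) -
      (z ^ 3 - z) * (z ^ 5 - z)) =
        d * ∑ a : Fin 11, (dissCoeff a 5 : ℂ) * z ^ (a : ℕ) ∧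
    11 * (1 - z) * -((1 - z ^ 4) * (z ^ 5 - z) -
      (z ^ 7 - z ^ 8) * (1 - z ^ 6)) =
        d * ∑ a : Fin 11, (dissCoeff a 6 : ℂ) * z ^ (a : ℕ) ∧
    11 * (1 - z) * -((z ^ 10 - z ^ 5) * (z ^ 9 - z ^ 8) -
      (z ^ 6 - z ^ 9) * (z ^ 4 - z ^ 2)) =
        d * ∑ a : Fin 11, (dissCoeff a 7 : ℂ) * z ^ (a : ℕ) ∧
    11 * (1 - z) * -((z ^ 3 - z) * (z ^ 4 - z ^ 2) -
      (z ^ 10 - z ^ 5) * (z ^ 10 - z ^ 7)) =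
        d * ∑ a : Fin 11, (dissCoeff a 8 : ℂ) * z ^ (a : ℕ) ∧
    11 * (1 - z) * ((z ^ 3 - z) * (z ^ 9 - z ^ 8) -
      (z ^ 6 - z ^ 9) * (z ^ 10 - z ^ 7)) =
        d * ∑ a : Fin 11, (dissCoeff a 9 : ℂ) * z ^ (a : ℕ) := by
  have hs (t : Fin 10) (c0 c1 c2 c3 c4 c5 : ℤ) (h0 : dissCoeff 0 t = c0) (h1 : dissCoeff 1 t = c1)
      (h2 : dissCoeff 2 t = c2) (h3 : dissCoeff 3 t = c3) (h4 : dissCoeff 4 t = c4)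
      (h5 : dissCoeff 5 t = c5) : ∑ a : Fin 11, (dissCoeff a t : ℂ) * z ^ (a : ℕ) =
      c0 + c1 * (z + z ^ 10) + c2 * (z ^ 2 + z ^ 9) + c3 * (z ^ 3 + z ^ 8) + c4 * (z ^ 4 + z ^ 7) +
        c5 * (z ^ 5 + z ^ 6) := by
    have g1 : dissCoeff 10 t = c1 := h1
    have g2 : dissCoeff 9 t = c2 := h2
    have g3 : dissCoeff 8 t = c3 := h3
    have g4 : dissCoeff 7 t = c4 := h4
    have g5 : dissCoeff 6 t = c5 := h5
    simp only [Fin.sum_univ_succ, Fin.sum_univ_zero, Fin.val_zero, Fin.val_succ]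
    simp [h0, h1, h2, h3, h4, h5, g1, g2, g3, g4, g5]
    ring
  refine ⟨?_, ?_, ?_, ?_, ?_, ?_, ?_, ?_, ?_, ?_⟩
  · rw [hs 0 10 (-1) (-1) (-1) (-1) (-1) rfl rfl rfl rfl rfl rfl, hd]
    push_cast
    linear_combination
      (z ^ 2 - z ^ 3 - z ^ 4 - 10 * z ^ 6 + 22 * z ^ 7 - 22 * z ^ 9 + 12 * z ^ 10 - z ^ 12 - z ^
      16 + z ^ 18 + z ^ 19 - z ^ 20) * h
  · rw [hs 1 (-12) 10 (-1) (-1) (-1) (-1) rfl rfl rfl rfl rfl rfl, hd]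
    push_cast
    linear_combination
      (12 * z ^ 2 - 34 * z ^ 3 + 21 * z ^ 4 + 11 * z ^ 5 - 10 * z ^ 6 - 11 * z ^ 8 + 44 * z ^ 9 -
      43 * z ^ 10 + 10 * z ^ 12 - 11 * z ^ 15 + 10 * z ^ 16 + 11 * z ^ 17 + z ^ 18 - 21 * z ^ 19
      + 10 * z ^ 20) * h
  · rw [hs 2 (-2) (-2) 9 (-2) (-2) (-2) rfl rfl rfl rfl rfl rfl, hd]
    push_cast
    linear_combination
      (11 * z - 20 * z ^ 2 - 2 * z ^ 3 + 9 * z ^ 4 + 11 * z ^ 5 + 2 * z ^ 6 - 33 * z ^ 7 + 33 * z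
      ^ 8 - 9 * z ^ 10 - 11 * z ^ 11 + 9 * z ^ 12 - 11 * z ^ 14 + 11 * z ^ 15 + 9 * z ^ 16 - 20 *
      z ^ 18 + 13 * z ^ 19 - 2 * z ^ 20) * h
  · rw [hs 3 8 (-3) (-3) 8 (-3) (-3) rfl rfl rfl rfl rfl rfl, hd]
    push_cast
    linear_combination
      (-8 * z ^ 2 + 19 * z ^ 3 - 3 * z ^ 4 - 22 * z ^ 5 + 3 * z ^ 6 + 33 * z ^ 7 - 22 * z ^ 8 -
      22 * z ^ 9 + 36 * z ^ 10 - 25 * z ^ 12 + 11 * z ^ 14 + 11 * z ^ 15 - 3 * z ^ 16 - 22 * z ^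
      17 + 14 * z ^ 18 + 3 * z ^ 19 - 3 * z ^ 20) * h
  · rw [hs 4 6 (-5) 6 (-5) 6 (-5) rfl rfl rfl rfl rfl rfl, hd]
    push_cast
    linear_combination
      (-6 * z ^ 2 + 17 * z ^ 3 - 16 * z ^ 4 + 11 * z ^ 5 - 17 * z ^ 6 + 11 * z ^ 7 + 11 * z ^ 8 -
      22 * z ^ 9 + 16 * z ^ 10 - 5 * z ^ 12 - 11 * z ^ 13 + 11 * z ^ 14 + 11 * z ^ 15 - 16 * z ^
      16 + 11 * z ^ 17 - 17 * z ^ 18 + 16 * z ^ 19 - 5 * z ^ 20) * h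
  · rw [hs 5 4 4 (-7) 4 (-7) 4 rfl rfl rfl rfl rfl rfl, hd]
    push_cast
    linear_combination
      (7 * z ^ 2 - 18 * z ^ 3 + 15 * z ^ 4 - 15 * z ^ 6 + 11 * z ^ 7 + 11 * z ^ 8 - 11 * z ^ 9 -
      4 * z ^ 10 + 4 * z ^ 12 + 11 * z ^ 13 - 11 * z ^ 14 - 11 * z ^ 15 + 15 * z ^ 16 - 11 * z ^
      17 + 18 * z ^ 18 - 15 * z ^ 19 + 4 * z ^ 20) * h
  · rw [hs 6 (-4) 7 (-4) (-4) 7 (-4) rfl rfl rfl rfl rfl rfl, hd]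
    push_cast
    linear_combination
      (11 * z - 18 * z ^ 2 - 4 * z ^ 3 + 18 * z ^ 4 - 22 * z ^ 5 + 26 * z ^ 6 - 22 * z ^ 8 + 22 *
      z ^ 9 - 18 * z ^ 10 + 11 * z ^ 11 - 4 * z ^ 12 - 11 * z ^ 13 + 22 * z ^ 14 - 11 * z ^ 15 -
      15 * z ^ 16 + 22 * z ^ 17 + 4 * z ^ 18 - 18 * z ^ 19 + 7 * z ^ 20) * h
  · rw [hs 7 (-6) 5 (-6) 5 5 (-6) rfl rfl rfl rfl rfl rfl, hd]
    push_cast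
    linear_combination
      (6 * z ^ 2 - 17 * z ^ 3 + 16 * z ^ 4 - 11 * z ^ 5 + 6 * z ^ 6 + 11 * z ^ 7 - 11 * z ^ 8 -
      11 * z ^ 9 + 17 * z ^ 10 + 11 * z ^ 11 - 28 * z ^ 12 - 11 * z ^ 13 + 33 * z ^ 14 - 17 * z ^
      16 + 17 * z ^ 18 - 16 * z ^ 19 + 5 * z ^ 20) * h
  · rw [hs 8 (-8) 3 3 3 (-8) 3 rfl rfl rfl rfl rfl rfl, hd]
    push_cast
    linear_combination
      (8 * z ^ 2 - 30 * z ^ 3 + 25 * z ^ 4 + 22 * z ^ 5 - 25 * z ^ 6 - 22 * z ^ 7 + 22 * z ^ 8 +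
      11 * z ^ 9 - 3 * z ^ 10 - 22 * z ^ 11 + 14 * z ^ 12 + 11 * z ^ 13 - 22 * z ^ 14 + 25 * z ^
      16 - 11 * z ^ 17 - 3 * z ^ 18 - 3 * z ^ 19 + 3 * z ^ 20) * h
  · rw [hs 9 2 2 2 (-9) 2 2 rfl rfl rfl rfl rfl rfl, hd]
    push_cast
    linear_combination
      (-2 * z ^ 2 + 2 * z ^ 3 + 2 * z ^ 4 + 11 * z ^ 5 - 24 * z ^ 6 + 11 * z ^ 8 + 22 * z ^ 9 -
      35 * z ^ 10 + 24 * z ^ 12 - 11 * z ^ 14 - 11 * z ^ 15 + 2 * z ^ 16 + 22 * z ^ 17 - 13 * z ^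
      18 - 2 * z ^ 19 + 2 * z ^ 20) * h

/-- The products of `x₁, …, x₅` occurring in the dissection, cleared of denominators. -/
def dissNum {R : Type*} [CommRing R] (q x₁ x₂ x₃ x₄ x₅ : R) : Fin 10 → R :=
  ![x₂ * x₃ * x₄ * x₅, q * (x₁ * x₄ * x₅ ^ 2), q ^ 2 * (x₂ * x₃ ^ 2 * x₅),
    q ^ 3 * (x₂ ^ 2 * x₄ * x₅), q ^ 4 * (x₁ * x₃ * x₄ * x₅), q ^ 5 * (x₁ * x₃ * x₄ ^ 2),
    q ^ 7 * (x₁ * x₂ * x₄ * x₅), q ^ 19 * (x₁ ^ 2 * x₂ * x₃), q ^ 9 * (x₁ * x₂ * x₃ * x₅),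
    q ^ 10 * (x₁ * x₂ * x₃ * x₄)]

lemma winquist_dissection_root {q ζ : ℂ} (hq : q ≠ 0) (hq1 : ‖q‖ < 1)
    (hζ : IsPrimitiveRoot ζ 11) :
    11 * (1 - ζ) * (poch (q ^ 121) (q ^ 121) ^ 2 *
      (winqB q (ζ ^ 5) * winqA q (ζ ^ 2) - winqA q (ζ ^ 5) * winqB q (ζ ^ 2))) =
    (1 - ζ) * (1 - ζ ^ 2) * (1 - ζ ^ 3) * (1 - ζ ^ 5) * (1 - ζ ^ 7) * ζ ^ 2 *
      ∑ t, (∑ a : Fin 11, (dissCoeff a t : ℂ) * ζ ^ (a : ℕ)) *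
        dissNum q (xTheta q 1) (xTheta q 2) (xTheta q 3) (xTheta q 4) (xTheta q 5) t := by
  have h11 := hζ.pow_eq_one
  have hp (a b r k : ℕ) (h : a * b = r + 11 * k) : (ζ ^ a) ^ b = ζ ^ r := by
    rw [← pow_mul, h, pow_add, pow_mul, h11, one_pow, mul_one]
  have hd := winquist_dissection hq hq1 (hp 5 11 0 5 rfl) (hp 2 11 0 2 rfl)
  have hΦ : 1 + ζ + ζ ^ 2 + ζ ^ 3 + ζ ^ 4 + ζ ^ 5 + ζ ^ 6 + ζ ^ 7 + ζ ^ 8 + ζ ^ 9 + ζ ^ 10 = 0 := by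
    have := hζ.geom_sum_eq_zero (by norm_num)
    simpa only [Finset.sum_range_succ, Finset.sum_range_zero, zero_add, pow_zero, pow_one]
      using this
  simp only [hp 5 10 6 4 rfl, hp 5 4 9 1 rfl, hp 5 2 10 0 rfl, hp 5 5 3 2 rfl, hp 5 9 1 4 rfl, hp 5 8 7 3
    rfl, hp 5 6 8 2 rfl, hp 5 3 4 1 rfl, hp 2 10 9 1 rfl, hp 2 4 8 0 rfl, hp 2 2 4 0 rfl, hp 2 5
    10 0 rfl, hp 2 9 7 1 rfl, hp 2 8 5 1 rfl, hp 2 6 1 1 rfl, hp 2 3 6 0 rfl, pow_one] at hd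
  obtain ⟨k0, k1, k2, k3, k4, k5, k6, k7, k8, k9⟩ := dissCoeff_eval hΦ rfl
  rw [hd]
  have hsum (f g : Fin 10 → ℂ) : ∑ t, f t * g t = f 0 * g 0 + f 1 * g 1 + f 2 * g 2 + f 3 * g 3 +
      f 4 * g 4 + f 5 * g 5 + f 6 * g 6 + f 7 * g 7 + f 8 * g 8 + f 9 * g 9 := by
    simp only [Fin.sum_univ_succ, Fin.sum_univ_zero]
    simp
    ring
  rw [hsum]
  clear hd hsum hp hΦ
  generalize xTheta q 1 = x1
  generalize xTheta q 2 = x2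
  generalize xTheta q 3 = x3
  generalize xTheta q 4 = x4
  generalize xTheta q 5 = x5
  generalize ∑ a : Fin 11, (dissCoeff a 0 : ℂ) * ζ ^ (a : ℕ) = s0 at *
  generalize ∑ a : Fin 11, (dissCoeff a 1 : ℂ) * ζ ^ (a : ℕ) = s1 at *
  generalize ∑ a : Fin 11, (dissCoeff a 2 : ℂ) * ζ ^ (a : ℕ) = s2 at *
  generalize ∑ a : Fin 11, (dissCoeff a 3 : ℂ) * ζ ^ (a : ℕ) = s3 at *
  generalize ∑ a : Fin 11, (dissCoeff a 4 : ℂ) * ζ ^ (a : ℕ) = s4 at *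
  generalize ∑ a : Fin 11, (dissCoeff a 5 : ℂ) * ζ ^ (a : ℕ) = s5 at *
  generalize ∑ a : Fin 11, (dissCoeff a 6 : ℂ) * ζ ^ (a : ℕ) = s6 at *
  generalize ∑ a : Fin 11, (dissCoeff a 7 : ℂ) * ζ ^ (a : ℕ) = s7 at *
  generalize ∑ a : Fin 11, (dissCoeff a 8 : ℂ) * ζ ^ (a : ℕ) = s8 at *
  generalize ∑ a : Fin 11, (dissCoeff a 9 : ℂ) * ζ ^ (a : ℕ) = s9 at *
  have n0 : dissNum q x1 x2 x3 x4 x5 0 = x2 * x3 * x4 * x5 := rfl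
  have n1 : dissNum q x1 x2 x3 x4 x5 1 = q * (x1 * x4 * x5 ^ 2) := rfl
  have n2 : dissNum q x1 x2 x3 x4 x5 2 = q ^ 2 * (x2 * x3 ^ 2 * x5) := rfl
  have n3 : dissNum q x1 x2 x3 x4 x5 3 = q ^ 3 * (x2 ^ 2 * x4 * x5) := rfl
  have n4 : dissNum q x1 x2 x3 x4 x5 4 = q ^ 4 * (x1 * x3 * x4 * x5) := rfl
  have n5 : dissNum q x1 x2 x3 x4 x5 5 = q ^ 5 * (x1 * x3 * x4 ^ 2) := rfl
  have n6 : dissNum q x1 x2 x3 x4 x5 6 = q ^ 7 * (x1 * x2 * x4 * x5) := rfl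
  have n7 : dissNum q x1 x2 x3 x4 x5 7 = q ^ 19 * (x1 ^ 2 * x2 * x3) := rfl
  have n8 : dissNum q x1 x2 x3 x4 x5 8 = q ^ 9 * (x1 * x2 * x3 * x5) := rfl
  have n9 : dissNum q x1 x2 x3 x4 x5 9 = q ^ 10 * (x1 * x2 * x3 * x4) := rfl
  rw [n0, n1, n2, n3, n4, n5, n6, n7, n8, n9]
  clear n0 n1 n2 n3 n4 n5 n6 n7 n8 n9
  generalize (1 - ζ) * (1 - ζ ^ 2) * (1 - ζ ^ 3) * (1 - ζ ^ 5) * (1 - ζ ^ 7) * ζ ^ 2 = d at *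
  linear_combination (x2 * x3 * x4 * x5) * k0 +
    (q * (x1 * x4 * x5 ^ 2)) * k1 +
    (q ^ 2 * (x2 * x3 ^ 2 * x5)) * k2 +
    (q ^ 3 * (x2 ^ 2 * x4 * x5)) * k3 +
    (q ^ 4 * (x1 * x3 * x4 * x5)) * k4 +
    (q ^ 5 * (x1 * x3 * x4 ^ 2)) * k5 +
    (q ^ 7 * (x1 * x2 * x4 * x5)) * k6 +
    (q ^ 19 * (x1 ^ 2 * x2 * x3)) * k7 +
    (q ^ 9 * (x1 * x2 * x3 * x5)) * k8 +
    (q ^ 10 * (x1 * x2 * x3 * x4)) * k9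

lemma crank_theta_dissection {q ζ C : ℂ} (hq : q ≠ 0) (hq1 : ‖q‖ < 1) (hζ : IsPrimitiveRoot ζ 11)
    (hC : C * theta q ζ = (1 - ζ) * poch q q ^ 2) :
    11 * C * (xTheta q 1 * xTheta q 2 * xTheta q 3 * xTheta q 4 * xTheta q 5) =
      poch (q ^ 121) (q ^ 121) ^ 2 * ∑ t, (∑ a : Fin 11, (dissCoeff a t : ℂ) * ζ ^ (a : ℕ)) *
        dissNum q (xTheta q 1) (xTheta q 2) (xTheta q 3) (xTheta q 4) (xTheta q 5) t := by
  have h11 := hζ.pow_eq_one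
  have h0 : ζ ≠ 0 := hζ.ne_zero (by norm_num)
  have hne (k : ℕ) (hk : 0 < k) (hk' : k < 11) : 1 - ζ ^ k ≠ 0 :=
    sub_ne_zero.2 (hζ.pow_ne_one_of_pos_of_lt hk.ne' hk').symm
  have hd : (1 - ζ) * (1 - ζ ^ 2) * (1 - ζ ^ 3) * (1 - ζ ^ 5) * (1 - ζ ^ 7) * ζ ^ 2 ≠ 0 := by
    have h1 := hne 1 (by norm_num) (by norm_num)
    rw [pow_one] at h1
    exact mul_ne_zero (mul_ne_zero (mul_ne_zero (mul_ne_zero (mul_ne_zero h1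
      (hne 2 (by norm_num) (by norm_num))) (hne 3 (by norm_num) (by norm_num)))
      (hne 5 (by norm_num) (by norm_num))) (hne 7 (by norm_num) (by norm_num))) (pow_ne_zero 2 h0)
  have hw := winquist hq hq1 (pow_ne_zero 5 h0) (pow_ne_zero 2 h0)
  rw [← pow_add, show ζ ^ 5 / ζ ^ 2 = ζ ^ 3 by field_simp, show 5 + 2 = 7 from rfl] at hw
  have hr := prod_theta_eleventh_root hq hq1 hζ
  have hp := prod_theta_pow_eleven (pow_ne_zero 11 hq) (norm_pow_lt_one hq1 (by norm_num : 11 ≠ 0))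
  have hX (m : ℕ) : theta ((q ^ 11) ^ 11) ((q ^ 11) ^ m) = xTheta q m := by
    rw [xTheta, ← pow_mul, ← pow_mul]
  have hX1 : theta ((q ^ 11) ^ 11) (q ^ 11) = xTheta q 1 := by rw [← hX 1, pow_one]
  rw [hX, hX, hX, hX, hX1, ← pow_mul, show 11 * 11 = 121 from rfl] at hp
  have hE : poch q q ≠ 0 := poch_self_ne_zero hq1
  have hQ : poch (q ^ 121) (q ^ 121) ≠ 0 :=
    poch_self_ne_zero (norm_pow_lt_one hq1 (by norm_num))
  have hz := winquist_dissection_root hq hq1 hζ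
  generalize ∑ t, (∑ a : Fin 11, (dissCoeff a t : ℂ) * ζ ^ (a : ℕ)) *
    dissNum q (xTheta q 1) (xTheta q 2) (xTheta q 3) (xTheta q 4) (xTheta q 5) t = S at *
  generalize winqB q (ζ ^ 5) * winqA q (ζ ^ 2) - winqA q (ζ ^ 5) * winqB q (ζ ^ 2) = W at *
  generalize (1 - ζ) * (1 - ζ ^ 2) * (1 - ζ ^ 3) * (1 - ζ ^ 5) * (1 - ζ ^ 7) = d at *
  have key : C * d * ζ ^ 2 * poch (q ^ 11) (q ^ 11) = (1 - ζ) * W := by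
    refine mul_left_cancel₀ (pow_ne_zero 4 hE) ?_
    linear_combination (-C * ζ ^ 2) * hr +
      (ζ ^ 2 * theta q (ζ ^ 2) * theta q (ζ ^ 3) * theta q (ζ ^ 5) * theta q (ζ ^ 7)) * hC +
      (1 - ζ) * poch q q ^ 2 * hw
  refine mul_left_cancel₀ hd ?_
  rw [hp]
  linear_combination 11 * poch (q ^ 121) (q ^ 121) ^ 4 * key + poch (q ^ 121) (q ^ 121) ^ 2 * hz

/-- The power series `φ` converges at `q` with sum `v`. -/
def HasEval (q : ℂ) (φ : PowerSeries ℂ) (v : ℂ) : Prop :=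
  HasSum (fun n => PowerSeries.coeff n φ * q ^ n) v

lemma HasEval.add {q u v : ℂ} {φ ψ : PowerSeries ℂ} (hφ : HasEval q φ u) (hψ : HasEval q ψ v) :
    HasEval q (φ + ψ) (u + v) :=
  hasSum_of_eq (HasSum.add hφ hψ) (fun n => by rw [map_add, add_mul]) rfl

lemma HasEval.mul {q u v : ℂ} {φ ψ : PowerSeries ℂ} (hφ : HasEval q φ u) (hψ : HasEval q ψ v) :
    HasEval q (φ * ψ) (u * v) := by
  have h1 := hφ.summable.norm
  have h2 := hψ.summable.norm
  have h := (summable_norm_sum_mul_antidiagonal_of_summable_norm h1 h2).of_norm.hasSum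
  rw [← tsum_mul_tsum_eq_tsum_sum_antidiagonal_of_summable_norm h1 h2, hφ.tsum_eq, hψ.tsum_eq] at h
  refine hasSum_of_eq h (fun n => ?_) rfl
  rw [PowerSeries.coeff_mul, Finset.sum_mul]
  refine Finset.sum_congr rfl fun p hp => ?_
  rw [← Finset.HasAntidiagonal.mem_antidiagonal.1 hp, pow_add]
  ring

lemma hasEval_C (q c : ℂ) : HasEval q (PowerSeries.C c) c :=
  hasSum_of_eq (hasSum_ite_eq 0 c) (fun n => by
    rw [PowerSeries.coeff_C]; split_ifs with h <;> simp [h]) rfl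

lemma hasEval_X (q : ℂ) : HasEval q PowerSeries.X q :=
  hasSum_of_eq (hasSum_ite_eq 1 q) (fun n => by
    rw [PowerSeries.coeff_X]; split_ifs with h <;> simp [h]) rfl

lemma hasEval_one (q : ℂ) : HasEval q 1 1 := by
  simpa using hasEval_C q 1

lemma HasEval.pow {q u : ℂ} {φ : PowerSeries ℂ} (hφ : HasEval q φ u) (n : ℕ) :
    HasEval q (φ ^ n) (u ^ n) := by
  induction n with
  | zero => simpa using hasEval_one q
  | succ n ih => rw [pow_succ, pow_succ]; exact ih.mul hφ

lemma hasEval_prod {ι : Type*} {q : ℂ} (s : Finset ι) {φ : ι → PowerSeries ℂ} {v : ι → ℂ}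
    (h : ∀ i ∈ s, HasEval q (φ i) (v i)) : HasEval q (∏ i ∈ s, φ i) (∏ i ∈ s, v i) := by
  classical
  induction s using Finset.induction_on with
  | empty => simpa using hasEval_one q
  | insert a s ha ih =>
    rw [Finset.prod_insert ha, Finset.prod_insert ha]
    exact (h a (by simp)).mul (ih fun i hi => h i (by simp [hi]))

lemma hasEval_sum {ι : Type*} {q : ℂ} (s : Finset ι) {φ : ι → PowerSeries ℂ} {v : ι → ℂ}
    (h : ∀ i ∈ s, HasEval q (φ i) (v i)) : HasEval q (∑ i ∈ s, φ i) (∑ i ∈ s, v i) := by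
  classical
  induction s using Finset.induction_on with
  | empty => simpa using hasEval_C q 0
  | insert a s ha ih =>
    rw [Finset.sum_insert ha, Finset.sum_insert ha]
    exact (h a (by simp)).add (ih fun i hi => h i (by simp [hi]))

open scoped PowerSeries.WithPiTopology in
lemma hasEval_genFun_factor {q v : ℂ} (f : ℕ → ℕ → ℂ) (i : ℕ)
    (h : HasSum (fun j => f (i + 1) (j + 1) * q ^ ((i + 1) * (j + 1))) v) :
    HasEval q (1 + ∑' j, f (i + 1) (j + 1) • PowerSeries.X ^ ((i + 1) * (j + 1))) (1 + v) := by
  have hc (n : ℕ) : PowerSeries.coeff n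
      (∑' j, f (i + 1) (j + 1) • (PowerSeries.X : PowerSeries ℂ) ^ ((i + 1) * (j + 1))) =
      ∑' j, if n = (i + 1) * (j + 1) then f (i + 1) (j + 1) else 0 := by
    rw [(Nat.Partition.summable_genFun_term f i).map_tsum (PowerSeries.coeff n)
      (PowerSeries.WithPiTopology.continuous_coeff ℂ n)]
    refine tsum_congr fun j => ?_
    rw [map_smul, PowerSeries.coeff_X_pow, smul_eq_mul, mul_ite, mul_one, mul_zero]
  refine (hasEval_one q).add ?_
  have hinj : Function.Injective fun j : ℕ => (i + 1) * (j + 1) := fun a b hab => by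
    simpa using hab
  refine (hinj.hasSum_iff ?_).1 (hasSum_of_eq h (fun j => ?_) rfl)
  · intro n hn
    rw [hc, tsum_congr (g := fun _ => 0), tsum_zero, zero_mul]
    exact fun j => if_neg fun hj => hn ⟨j, hj.symm⟩
  · rw [Function.comp_apply, hc, tsum_eq_single j, if_pos rfl]
    intro b hb
    exact if_neg fun hj => hb (hinj hj.symm)

lemma card_partition_le (n : ℕ) : Fintype.card n.Partition ≤ 2 ^ n := by
  have h := Fintype.card_le_of_surjective _ (Nat.Partition.ofComposition_surj (n := n))
  rw [composition_card] at h
  exact h.trans (Nat.pow_le_pow_right (by norm_num) (Nat.sub_le n 1))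

lemma summable_card_partition {r : ℝ} (h0 : 0 ≤ r) (hr : r < 1 / 2) :
    Summable fun n : ℕ => (Fintype.card n.Partition : ℝ) * r ^ n := by
  refine Summable.of_nonneg_of_le (fun n => by positivity) (fun n => ?_)
    (summable_geometric_of_lt_one (r := 2 * r) (by linarith) (by linarith))
  rw [mul_pow]
  gcongr
  exact_mod_cast card_partition_le n

lemma norm_finsuppProd_le_one {n : ℕ} (f : ℕ → ℕ → ℂ) (hf : ∀ i c, ‖f i c‖ ≤ 1)
    (p : n.Partition) : ‖p.parts.toFinsupp.prod f‖ ≤ 1 := by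
  rw [Finsupp.prod, norm_prod]
  exact Finset.prod_le_one (fun _ _ => norm_nonneg _) fun _ _ => hf _ _

lemma norm_coeff_genFun_le (f : ℕ → ℕ → ℂ) (hf : ∀ i c, ‖f i c‖ ≤ 1) (n : ℕ) :
    ‖PowerSeries.coeff n (Nat.Partition.genFun f)‖ ≤ Fintype.card n.Partition := by
  rw [Nat.Partition.coeff_genFun]
  refine (norm_sum_le_of_le _ fun p _ => norm_finsuppProd_le_one f hf p).trans ?_
  simp

open scoped PowerSeries.WithPiTopology in
lemma genFun_truncate (f : ℕ → ℕ → ℂ) (N : ℕ) :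
    Nat.Partition.genFun (fun i c => if i ≤ N then f i c else 0) =
      ∏ i ∈ Finset.range N,
        (1 + ∑' j, f (i + 1) (j + 1) • (PowerSeries.X : PowerSeries ℂ) ^ ((i + 1) * (j + 1))) := by
  have h := Nat.Partition.hasProd_genFun (fun i c => if i ≤ N then f i c else 0)
  have h2 := hasProd_prod_of_ne_finset_one (s := Finset.range N) (f := fun i => 1 + ∑' j,
    (if i + 1 ≤ N then f (i + 1) (j + 1) else 0) •
      (PowerSeries.X : PowerSeries ℂ) ^ ((i + 1) * (j + 1))) (L := .unconditional ℕ) (by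
      intro i hi
      rw [Finset.mem_range] at hi
      simp [show ¬ (i + 1 ≤ N) by omega])
  rw [h.unique h2]
  refine Finset.prod_congr rfl fun i hi => ?_
  rw [Finset.mem_range] at hi
  simp [show i + 1 ≤ N by omega]

/-- Evaluation of the generating function of a multiplicative partition statistic. -/
lemma hasEval_genFun {q v : ℂ} (hq : ‖q‖ < 1 / 2) (f : ℕ → ℕ → ℂ) (hf : ∀ i c, ‖f i c‖ ≤ 1)
    (s : ℕ → ℂ)
    (hs : ∀ i, HasSum (fun j => f (i + 1) (j + 1) * q ^ ((i + 1) * (j + 1))) (s i))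
    (hv : Tendsto (fun N => ∏ i ∈ Finset.range N, (1 + s i)) atTop (𝓝 v)) :
    HasEval q (Nat.Partition.genFun f) v := by
  have hb : Summable fun n : ℕ => (Fintype.card n.Partition : ℝ) * ‖q‖ ^ n :=
    summable_card_partition (norm_nonneg q) hq
  have hle (g : ℕ → ℕ → ℂ) (hg : ∀ i c, ‖g i c‖ ≤ 1) (n : ℕ) :
      ‖PowerSeries.coeff n (Nat.Partition.genFun g) * q ^ n‖ ≤
        (Fintype.card n.Partition : ℝ) * ‖q‖ ^ n := by
    rw [norm_mul, norm_pow]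
    gcongr
    exact norm_coeff_genFun_le g hg n
  have hlim := tendsto_tsum_of_dominated_convergence (𝓕 := atTop) hb
    (f := fun N n => PowerSeries.coeff n
      (Nat.Partition.genFun (fun i c => if i ≤ N then f i c else 0)) * q ^ n)
    (g := fun n => PowerSeries.coeff n (Nat.Partition.genFun f) * q ^ n)
    (fun n => tendsto_atTop_of_eventually_const (i₀ := n) fun N hN => by
      rw [Nat.Partition.coeff_genFun, Nat.Partition.coeff_genFun]
      congr 1
      refine Finset.sum_congr rfl fun p _ => ?_
      refine Finsupp.prod_congr fun i hi => ?_
      rw [Multiset.toFinsupp_support, Multiset.mem_toFinset] at hi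
      exact if_pos ((p.le_of_mem_parts hi).trans hN))
    (Eventually.of_forall fun N n => hle _ (fun i c => by
      split_ifs
      · exact hf i c
      · simp) n)
  have hev (N : ℕ) := hasEval_prod (Finset.range N) fun i _ => hasEval_genFun_factor f i (hs i)
  have heq : v = ∑' n, PowerSeries.coeff n (Nat.Partition.genFun f) * q ^ n := by
    refine tendsto_nhds_unique hv (hlim.congr fun N => ?_)
    rw [genFun_truncate]
    exact (hev N).tsum_eq
  rw [heq]
  exact (Summable.of_norm_bounded hb (hle f hf)).hasSum

/-- The coefficients `(a; q)_n / (q; q)_n` of the `q`-binomial series. -/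
def qbinCoeff (q a : ℂ) (n : ℕ) : ℂ := (∏ i ∈ Finset.range n, (1 - a * q ^ i)) / qfac q n

lemma qbinCoeff_zero (q a : ℂ) : qbinCoeff q a 0 = 1 := by simp [qbinCoeff, qfac]

lemma qbinCoeff_succ {q : ℂ} (hq1 : ‖q‖ < 1) (a : ℂ) (n : ℕ) :
    qbinCoeff q a (n + 1) * (1 - q ^ (n + 1)) = qbinCoeff q a n * (1 - a * q ^ n) := by
  have h := one_sub_mul_pow_ne_zero hq1 hq1 n
  have h2 := qfac_ne_zero hq1 n
  have h3 : qfac q (n + 1) = qfac q n * (1 - q * q ^ n) := Finset.prod_range_succ _ _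
  rw [qbinCoeff, qbinCoeff, h3, Finset.prod_range_succ, pow_succ', div_mul_eq_mul_div,
    div_mul_eq_mul_div, div_eq_div_iff (mul_ne_zero h2 h) h2]
  ring

lemma exists_norm_qbinCoeff_le {q : ℂ} (hq1 : ‖q‖ < 1) (a : ℂ) :
    ∃ M, ∀ n, ‖qbinCoeff q a n‖ ≤ M := by
  have h : Tendsto (qbinCoeff q a) atTop (𝓝 (poch q a / poch q q)) :=
    (tendsto_poch hq1 a).div (tendsto_poch hq1 q) (poch_self_ne_zero hq1)
  obtain ⟨M, hM⟩ := (Metric.isBounded_range_of_tendsto _ h).exists_norm_le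
  exact ⟨M, fun n => hM _ ⟨n, rfl⟩⟩

lemma summable_qbin {q t : ℂ} (hq1 : ‖q‖ < 1) (ht : ‖t‖ < 1) (a : ℂ) :
    Summable fun n => qbinCoeff q a n * t ^ n := by
  obtain ⟨M, hM⟩ := exists_norm_qbinCoeff_le hq1 a
  refine Summable.of_norm_bounded
    ((summable_geometric_of_lt_one (norm_nonneg t) ht).mul_left M) fun n => ?_
  rw [norm_mul, norm_pow]
  exact mul_le_mul_of_nonneg_right (hM n) (by positivity)

lemma tsum_qbin_functional {q t : ℂ} (hq1 : ‖q‖ < 1) (ht : ‖t‖ < 1) (a : ℂ) :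
    (1 - t) * ∑' n, qbinCoeff q a n * t ^ n =
      (1 - a * t) * ∑' n, qbinCoeff q a n * (t * q) ^ n := by
  have htq : ‖t * q‖ < 1 := by
    rw [norm_mul]; exact mul_lt_one_of_nonneg_of_lt_one_left (norm_nonneg t) ht hq1.le
  have s1 := summable_qbin hq1 ht a
  have s2 := summable_qbin hq1 htq a
  have e1 := s1.tsum_eq_zero_add
  have e2 := s2.tsum_eq_zero_add
  have k1 := (summable_nat_add_iff 1).2 s1
  have k2 := (summable_nat_add_iff 1).2 s2
  have key : (∑' n, qbinCoeff q a (n + 1) * t ^ (n + 1)) - ∑' n, t * (qbinCoeff q a n * t ^ n) =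
      (∑' n, qbinCoeff q a (n + 1) * (t * q) ^ (n + 1)) -
        ∑' n, a * t * (qbinCoeff q a n * (t * q) ^ n) := by
    rw [← k1.tsum_sub (s1.mul_left t), ← k2.tsum_sub (s2.mul_left (a * t))]
    refine tsum_congr fun n => ?_
    have := qbinCoeff_succ hq1 a n
    rw [mul_pow, mul_pow]
    linear_combination t ^ (n + 1) * this
  rw [tsum_mul_left, tsum_mul_left] at key
  rw [pow_zero] at e1 e2
  linear_combination key + e1 - e2

/-- The `q`-binomial theorem. -/
theorem hasSum_qbin {q t : ℂ} (hq1 : ‖q‖ < 1) (ht : ‖t‖ < 1) (a : ℂ) :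
    HasSum (fun n => qbinCoeff q a n * t ^ n) (poch q (a * t) / poch q t) := by
  have htN (N : ℕ) : ‖t * q ^ N‖ ≤ ‖t‖ := by
    rw [norm_mul, norm_pow]
    exact mul_le_of_le_one_right (norm_nonneg t) (pow_le_one₀ (norm_nonneg q) hq1.le)
  have hne (N : ℕ) := one_sub_mul_pow_ne_zero hq1 ht N
  have iter (N : ℕ) : (∏ i ∈ Finset.range N, (1 - t * q ^ i)) * ∑' n, qbinCoeff q a n * t ^ n =
      (∏ i ∈ Finset.range N, (1 - a * t * q ^ i)) * ∑' n, qbinCoeff q a n * (t * q ^ N) ^ n := by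
    induction N with
    | zero => simp
    | succ N ih =>
      have := tsum_qbin_functional hq1 ((htN N).trans_lt ht) a
      rw [mul_assoc t, ← pow_succ, ← mul_assoc a] at this
      rw [Finset.prod_range_succ, Finset.prod_range_succ]
      linear_combination (1 - t * q ^ N) * ih + (∏ i ∈ Finset.range N, (1 - a * t * q ^ i)) * this
  obtain ⟨M, hM⟩ := exists_norm_qbinCoeff_le hq1 a
  have hq0 : Tendsto (fun N => t * q ^ N) atTop (𝓝 0) := by
    simpa using (tendsto_pow_atTop_nhds_zero_of_norm_lt_one hq1).const_mul t
  have hlim : Tendsto (fun N => ∑' n, qbinCoeff q a n * (t * q ^ N) ^ n) atTop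
      (𝓝 (∑' n, qbinCoeff q a n * 0 ^ n)) := by
    refine tendsto_tsum_of_dominated_convergence
      ((summable_geometric_of_lt_one (norm_nonneg t) ht).mul_left M)
      (fun n => (hq0.pow n).const_mul _) (Eventually.of_forall fun N n => ?_)
    rw [norm_mul, norm_pow]
    exact mul_le_mul (hM n) (pow_le_pow_left₀ (norm_nonneg _) (htN N) n) (by positivity)
      ((norm_nonneg _).trans (hM n))
  rw [tsum_eq_single 0 (fun n hn => by rw [zero_pow hn, mul_zero]), qbinCoeff_zero, pow_zero,
    one_mul] at hlim
  have h1 := (tendsto_poch hq1 t).mul_const (∑' n, qbinCoeff q a n * t ^ n)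
  have h2 := (tendsto_poch hq1 (a * t)).mul hlim
  have h := tendsto_nhds_unique (h1.congr iter) h2
  rw [← (eq_div_iff (poch_ne_zero hq1 hne)).2 (show (∑' n, qbinCoeff q a n * t ^ n) * poch q t = _
    by rw [mul_comm, h, mul_one])]
  exact (summable_qbin hq1 ht a).hasSum

lemma summable_partition {q : ℂ} (hq : ‖q‖ < 1 / 2) (w : (n : ℕ) → n.Partition → ℂ)
    (hw : ∀ n p, ‖w n p‖ ≤ 1) :
    Summable fun x : Σ n : ℕ, n.Partition => w x.1 x.2 * q ^ x.1 := by
  refine Summable.of_norm_bounded (g := fun x : Σ n : ℕ, n.Partition => ‖q‖ ^ x.1) ?_ fun x => ?_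
  · rw [summable_sigma_of_nonneg fun _ => by positivity]
    refine ⟨fun n => Summable.of_finite, ?_⟩
    refine (summable_card_partition (norm_nonneg q) hq).congr fun n => ?_
    simp [tsum_fintype]
  · rw [norm_mul, norm_pow]
    exact mul_le_of_le_one_left (by positivity) (hw _ _)

lemma hasSum_partition_fiberwise {q V : ℂ} (hq : ‖q‖ < 1 / 2) (w : (n : ℕ) → n.Partition → ℂ)
    (hw : ∀ n p, ‖w n p‖ ≤ 1) (l : (n : ℕ) → n.Partition → ℕ) (v : ℕ → ℂ)
    (h : ∀ j, HasSum (fun n => (∑ p, if l n p = j then w n p else 0) * q ^ n) (v j))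
    (hV : HasSum v V) : HasSum (fun n => (∑ p, w n p) * q ^ n) V := by
  have key (w' : (n : ℕ) → n.Partition → ℂ) (hw' : ∀ n p, ‖w' n p‖ ≤ 1) :
      HasSum (fun n => (∑ p, w' n p) * q ^ n)
        (∑' x : Σ n : ℕ, n.Partition, w' x.1 x.2 * q ^ x.1) := by
    refine (summable_partition hq w' hw').hasSum.sigma fun n => ?_
    rw [Finset.sum_mul]
    exact hasSum_fintype _
  have hfib := (summable_partition hq w hw).hasSum.tsum_fiberwise fun x => l x.1 x.2
  have hv (j : ℕ) : ∑' x : (fun x : Σ n : ℕ, n.Partition => l x.1 x.2) ⁻¹' {j},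
      w x.1.1 x.1.2 * q ^ x.1.1 = v j := by
    rw [tsum_subtype _ fun x : Σ n : ℕ, n.Partition => w x.1 x.2 * q ^ x.1]
    rw [(h j).unique (key (fun n p => if l n p = j then w n p else 0) fun n p => by
      split_ifs
      · exact hw n p
      · simp)]
    refine tsum_congr fun x => ?_
    by_cases hx : l x.1 x.2 = j
    · rw [if_pos hx, Set.indicator_of_mem (by exact hx)]
    · rw [if_neg hx, Set.indicator_of_notMem (by exact hx), zero_mul]
  rw [hV.unique (hasSum_of_eq hfib (fun j => (hv j).symm) rfl)]
  exact key w hw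

lemma hasSum_geometric_part {x : ℂ} (hx : ‖x‖ < 1) :
    HasSum (fun j : ℕ => x ^ (j + 1)) (x / (1 - x)) := by
  have h := (hasSum_geometric_of_norm_lt_one hx).mul_left x
  refine hasSum_of_eq h (fun j => pow_succ' x j) rfl

lemma one_add_geometric_part {x : ℂ} (hx : ‖x‖ < 1) : 1 + x / (1 - x) = (1 - x)⁻¹ := by
  have : 1 - x ≠ 0 := by
    intro h
    rw [← sub_eq_zero.1 h, norm_one] at hx
    exact lt_irrefl _ hx
  field_simp
  ring

/-- The multiplicative statistic marking partitions without ones and with parts at most `m`. -/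
def boundedWeight (m i _c : ℕ) : ℂ := if i = 1 then 0 else if i ≤ m then 1 else 0

lemma hasEval_boundedWeight {q : ℂ} (hq : ‖q‖ < 1 / 2) {m : ℕ} (hm : 0 < m) :
    HasEval q (Nat.Partition.genFun (boundedWeight m)) ((1 - q) / qfac q m) := by
  have hq1 : ‖q‖ < 1 := hq.trans (by norm_num)
  have hp (i : ℕ) : ‖q ^ (i + 1)‖ < 1 := norm_pow_lt_one hq1 i.succ_ne_zero
  refine hasEval_genFun hq _ (fun i c => ?_)
    (fun i => if i = 0 then 0 else if i < m then q ^ (i + 1) / (1 - q ^ (i + 1)) else 0)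
    (fun i => ?_) (tendsto_atTop_of_eventually_const (i₀ := m) fun N hN => ?_)
  · rw [boundedWeight]; split_ifs <;> simp
  · rcases Nat.eq_zero_or_pos i with rfl | hi
    · simp [boundedWeight, hasSum_zero]
    · by_cases h : i < m
      · simp only [boundedWeight, hi.ne', h, Nat.succ_le_of_lt h, if_false, if_true, one_mul,
          pow_mul, show ¬ (i + 1 = 1) by omega]
        exact hasSum_geometric_part (hp i)
      · simp [boundedWeight, hi.ne', h, show ¬ (i + 1 ≤ m) by omega, hasSum_zero]
  · induction N, hN using Nat.le_induction with
    | succ N hN ih =>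
      rw [Finset.prod_range_succ, ih, if_neg (by omega), if_neg (by omega), add_zero, mul_one]
    | base =>
      induction m, (show 1 ≤ m from hm) using Nat.le_induction with
      | base =>
        have h : (1 : ℂ) - q ≠ 0 := by simpa using one_sub_mul_pow_ne_zero hq1 hq1 0
        simp [qfac, div_self h]
      | succ m hm' ih =>
        rw [Finset.prod_range_succ, if_neg (by omega), if_pos (by omega),
          one_add_geometric_part (hp m), qfac, Finset.prod_range_succ, ← qfac, ← pow_succ',
          ← div_div, div_eq_mul_inv _ (1 - q ^ (m + 1)), ← ih hm']
        congr 1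
        refine Finset.prod_congr rfl fun i hi => ?_
        rw [Finset.mem_range] at hi
        simp [hi, hi.trans (Nat.lt_succ_self m)]

/-- The multiplicative statistic counting parts larger than `j`, with value `u` on ones. -/
def crankWeight (z : ℂ) (u : ℕ → ℂ) (j i c : ℕ) : ℂ :=
  if i = 1 then u c else if i ≤ j then 1 else z ^ c

lemma hasEval_crankWeight {q z s : ℂ} (hq : ‖q‖ < 1 / 2) (hz : ‖z‖ = 1) {u : ℕ → ℂ}
    (hu : ∀ c, ‖u c‖ ≤ 1) {j : ℕ} (hj : 0 < j) (hs : HasSum (fun c => u (c + 1) * q ^ (c + 1)) s) :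
    HasEval q (Nat.Partition.genFun (crankWeight z u j))
      ((1 + s) * ((1 - q) / poch q (z * q) * qbinCoeff q (z * q) j)) := by
  have hq1 : ‖q‖ < 1 := hq.trans (by norm_num)
  have hp (i : ℕ) : ‖q ^ (i + 1)‖ < 1 := norm_pow_lt_one hq1 i.succ_ne_zero
  have hzp (i : ℕ) : ‖z * q ^ (i + 1)‖ < 1 := by rw [norm_mul, hz, one_mul]; exact hp i
  have hzq : ‖z * q‖ < 1 := by simpa using hzp 0
  have hpne (N : ℕ) : ∏ i ∈ Finset.range N, (1 - z * q * q ^ i) ≠ 0 :=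
    Finset.prod_ne_zero_iff.2 fun i _ => one_sub_mul_pow_ne_zero hq1 hzq i
  refine hasEval_genFun hq _ (fun i c => ?_)
    (fun i => if i = 0 then s else if i < j then q ^ (i + 1) / (1 - q ^ (i + 1)) else
      z * q ^ (i + 1) / (1 - z * q ^ (i + 1))) (fun i => ?_) ?_
  · rw [crankWeight]
    split_ifs
    · exact hu c
    · simp
    · rw [norm_pow, hz, one_pow]
  · rcases Nat.eq_zero_or_pos i with rfl | hi
    · simpa [crankWeight] using hs
    · by_cases h : i < j
      · simp only [crankWeight, hi.ne', h, Nat.succ_le_of_lt h, if_false, if_true, one_mul,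
          pow_mul, show ¬ (i + 1 = 1) by omega]
        exact hasSum_geometric_part (hp i)
      · simp only [crankWeight, hi.ne', h, if_false, pow_mul, show ¬ (i + 1 = 1) by omega,
          show ¬ (i + 1 ≤ j) by omega, ← mul_pow]
        exact hasSum_geometric_part (hzp i)
  · have base : ∏ i ∈ Finset.range j, (1 + if i = 0 then s else
        if i < j then q ^ (i + 1) / (1 - q ^ (i + 1)) else
          z * q ^ (i + 1) / (1 - z * q ^ (i + 1))) = (1 + s) * (1 - q) / qfac q j := by
      induction j, (show 1 ≤ j from hj) using Nat.le_induction with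
      | base =>
        have h : (1 : ℂ) - q ≠ 0 := by simpa using one_sub_mul_pow_ne_zero hq1 hq1 0
        simp [qfac, mul_div_cancel_right₀ _ h]
      | succ m hm' ih =>
        rw [Finset.prod_range_succ, if_neg (by omega), if_pos (by omega),
          one_add_geometric_part (hp m), qfac, Finset.prod_range_succ, ← qfac, ← pow_succ',
          ← div_div, div_eq_mul_inv _ (1 - q ^ (m + 1))]
        congr 1
        rw [← ih hm']
        refine Finset.prod_congr rfl fun i hi => ?_
        rw [Finset.mem_range] at hi
        simp [hi, hi.trans (Nat.lt_succ_self m)]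
    have hlim := ((tendsto_poch hq1 (z * q)).inv₀
      (poch_ne_zero hq1 (one_sub_mul_pow_ne_zero hq1 hzq))).const_mul
        ((1 + s) * (1 - q) * qbinCoeff q (z * q) j)
    have hprod (N : ℕ) (hN : j ≤ N) : (1 + s) * (1 - q) * qbinCoeff q (z * q) j *
        (∏ i ∈ Finset.range N, (1 - z * q * q ^ i))⁻¹ =
        ∏ i ∈ Finset.range N, (1 + if i = 0 then s else
          if i < j then q ^ (i + 1) / (1 - q ^ (i + 1)) else
            z * q ^ (i + 1) / (1 - z * q ^ (i + 1))) := by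
      induction N, hN using Nat.le_induction with
      | base =>
        rw [base, qbinCoeff]
        have h1 := hpne j
        have h2 := qfac_ne_zero hq1 j
        generalize ∏ i ∈ Finset.range j, (1 - z * q * q ^ i) = P at h1
        field_simp
      | succ N hN ih =>
        rw [Finset.prod_range_succ, Finset.prod_range_succ, ← ih, if_neg (by omega),
          if_neg (by omega), one_add_geometric_part (hzp N), mul_inv, pow_succ', ← mul_assoc z]
        ring
    have h := hlim.congr' ((eventually_ge_atTop j).mono hprod)
    rw [show (1 + s) * (1 - q) * qbinCoeff q (z * q) j * (poch q (z * q))⁻¹ =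
      (1 + s) * ((1 - q) / poch q (z * q) * qbinCoeff q (z * q) j) by ring] at h
    exact h

lemma boundedWeight_prod (m : ℕ) {n : ℕ} (p : n.Partition) :
    p.parts.toFinsupp.prod (boundedWeight m) =
      if p.parts.count 1 = 0 ∧ p.parts.sup ≤ m then 1 else 0 := by
  rw [Finsupp.prod, Multiset.toFinsupp_support]
  split_ifs with h
  · refine Finset.prod_eq_one fun i hi => ?_
    rw [Multiset.mem_toFinset] at hi
    have h1 : i ≠ 1 := by rintro rfl; exact Multiset.count_eq_zero.1 h.1 hi
    rw [boundedWeight, if_neg h1, if_pos ((Multiset.le_sup hi).trans h.2)]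
  · rw [Finset.prod_eq_zero_iff]
    by_cases h1 : p.parts.count 1 = 0
    · have h2 : ¬ ∀ b ∈ p.parts, b ≤ m := fun hb => h ⟨h1, Multiset.sup_le.2 hb⟩
      push Not at h2
      obtain ⟨b, hb, hbm⟩ := h2
      have hb1 : b ≠ 1 := by rintro rfl; exact Multiset.count_eq_zero.1 h1 hb
      exact ⟨b, Multiset.mem_toFinset.2 hb, by rw [boundedWeight, if_neg hb1, if_neg hbm.not_ge]⟩
    · exact ⟨1, Multiset.mem_toFinset.2 (Multiset.count_ne_zero.1 h1), if_pos rfl⟩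

lemma sup_ne_one_of_count_eq_zero {n : ℕ} (p : n.Partition) (h : p.parts.count 1 = 0)
    (hs : p.parts.sup ≤ 1) : p.parts.sup = 0 := by
  have h0 : p.parts = 0 := Multiset.eq_zero_of_forall_notMem fun b hb => by
    have h1 := p.parts_pos hb
    have h2 := (Multiset.le_sup hb).trans hs
    obtain rfl : b = 1 := by omega
    exact Multiset.count_eq_zero.1 h hb
  rw [h0, Multiset.sup_zero]
  rfl

lemma crankWeight_prod (z : ℂ) (u : ℕ → ℂ) {j : ℕ} (hj : 0 < j) {n : ℕ} (p : n.Partition) :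
    p.parts.toFinsupp.prod (crankWeight z u j) =
      (if p.parts.count 1 = 0 then 1 else u (p.parts.count 1)) *
        z ^ (p.parts.filter fun x => j < x).card := by
  have h (s : Multiset ℕ) : z ^ (s.filter fun x => j < x).card =
      (s.map fun x => if j < x then z else 1).prod := by
    induction s using Multiset.induction_on with
    | empty => simp
    | cons a s ih => by_cases ha : j < a <;> simp [ha, ih, pow_succ']
  rw [h, Finset.prod_multiset_map_count, Finsupp.prod, Multiset.toFinsupp_support]
  have h1 : (if p.parts.count 1 = 0 then 1 else u (p.parts.count 1)) =
      ∏ i ∈ p.parts.toFinset, if i = 1 then u (p.parts.count i) else 1 := by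
    rw [Finset.prod_ite_eq']
    simp only [Multiset.mem_toFinset, ← Multiset.count_ne_zero]
    split_ifs <;> simp_all
  rw [h1, ← Finset.prod_mul_distrib]
  refine Finset.prod_congr rfl fun i _ => ?_
  rw [Multiset.toFinsupp_apply, crankWeight]
  by_cases hi : i = 1
  · subst hi
    simp [show ¬ j < 1 by omega]
  · by_cases hij : j < i
    · simp [hi, hij, hij.not_ge]
    · simp [hi, hij, not_lt.1 hij]

lemma poch_zero_right (q : ℂ) : poch q 0 = 1 := by simp [poch]

/-- Generating function of `z ^ crank` over partitions without ones. -/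
lemma hasSum_crank_no_ones {q z : ℂ} (hq : ‖q‖ < 1 / 2) (hz : ‖z‖ = 1) :
    HasSum (fun n => (∑ p : n.Partition,
        if p.parts.count 1 = 0 then z ^ partitionCrank p else 0) * q ^ n)
      (q - z * q + (1 - q) / poch q (z * q)) := by
  have hq1 : ‖q‖ < 1 := hq.trans (by norm_num)
  have hzq : ‖z * q‖ < 1 := by rwa [norm_mul, hz, one_mul]
  have h1q : (1 : ℂ) - q ≠ 0 := by simpa using one_sub_mul_pow_ne_zero hq1 hq1 0
  refine hasSum_partition_fiberwise hq _ (fun n p => ?_) (fun n p => p.parts.sup)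
    (fun m => (if m = 0 then q else 0) + (if m = 1 then -(z * q) else 0) +
      (1 - q) * (qbinCoeff q 0 m * (z * q) ^ m)) (fun m => ?_) ?_
  · split_ifs
    · rw [norm_zpow, hz, one_zpow]
    · simp
  · have hcr {n : ℕ} (p : n.Partition) : (if p.parts.sup = m then
        (if p.parts.count 1 = 0 then z ^ partitionCrank p else 0) else 0) =
        if p.parts.count 1 = 0 ∧ p.parts.sup = m then z ^ m else 0 := by
      by_cases h1 : p.parts.count 1 = 0
      · by_cases h2 : p.parts.sup = m
        · rw [if_pos h2, if_pos h1, if_pos ⟨h1, h2⟩, partitionCrank, if_pos h1, h2, zpow_natCast]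
        · rw [if_neg h2, if_neg fun h => h2 h.2]
      · rw [if_neg h1, ite_self, if_neg fun h => h1 h.1]
    simp only [hcr]
    have hbin (k : ℕ) : qbinCoeff q 0 k = (qfac q k)⁻¹ := by simp [qbinCoeff]
    obtain rfl | rfl | ⟨k, rfl⟩ : m = 0 ∨ m = 1 ∨ ∃ k, m = k + 2 := by
      rcases m with _ | _ | k
      · exact Or.inl rfl
      · exact Or.inr (Or.inl rfl)
      · exact Or.inr (Or.inr ⟨k, rfl⟩)
    · refine hasSum_of_eq (hasEval_boundedWeight hq one_pos) (fun n => ?_) ?_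
      · rw [Nat.Partition.coeff_genFun]
        congr 1
        refine Finset.sum_congr rfl fun p _ => ?_
        rw [boundedWeight_prod, pow_zero]
        congr 1
        exact propext ⟨fun h => ⟨h.1, by omega⟩,
          fun h => ⟨h.1, sup_ne_one_of_count_eq_zero p h.1 h.2⟩⟩
      · simp [qbinCoeff, qfac, div_self h1q]
    · refine hasSum_of_eq hasSum_zero (fun n => ?_) ?_
      · rw [Finset.sum_eq_zero, zero_mul]
        intro p _
        refine if_neg fun h => ?_
        have := sup_ne_one_of_count_eq_zero p h.1 h.2.le
        omega
      · simp [qbinCoeff, qfac]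
        field_simp
        ring
    · have e1 := hasEval_boundedWeight hq (show 0 < k + 2 by omega)
      have e2 := hasEval_boundedWeight hq (show 0 < k + 1 by omega)
      refine hasSum_of_eq ((HasSum.sub e1 e2).mul_left (z ^ (k + 2))) (fun n => ?_) ?_
      · rw [Nat.Partition.coeff_genFun, Nat.Partition.coeff_genFun, ← sub_mul,
          ← Finset.sum_sub_distrib, ← mul_assoc, Finset.mul_sum]
        congr 1
        refine Finset.sum_congr rfl fun p _ => ?_
        rw [boundedWeight_prod, boundedWeight_prod]
        by_cases h1 : p.parts.count 1 = 0
        · rcases lt_trichotomy p.parts.sup (k + 2) with h | h | h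
          · simp [h1, h.ne, h.le, show p.parts.sup ≤ k + 1 by omega]
          · simp [h1, h]
          · simp [h1, h.ne', h.not_ge, show ¬ p.parts.sup ≤ k + 1 by omega]
        · simp [h1]
      · have hf : qfac q (k + 2) = qfac q (k + 1) * (1 - q * q ^ (k + 1)) :=
          Finset.prod_range_succ _ _
        have h2 := qfac_ne_zero hq1 (k + 1)
        have h3 := one_sub_mul_pow_ne_zero hq1 hq1 (k + 1)
        rw [if_neg (by omega), if_neg (by omega), hbin, hf, mul_pow]
        field_simp
        ring
  · have h := (hasSum_qbin hq1 hzq 0).mul_left (1 - q)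
    refine hasSum_of_eq (((hasSum_ite_eq 0 q).add (hasSum_ite_eq 1 (-(z * q)))).add h)
      (fun m => rfl) ?_
    rw [zero_mul, poch_zero_right]
    ring

/-- Generating function of `z ^ crank` over partitions containing a one. -/
lemma hasSum_crank_ones {q z : ℂ} (hq : ‖q‖ < 1 / 2) (hz : ‖z‖ = 1) :
    HasSum (fun n => (∑ p : n.Partition,
        if p.parts.count 1 = 0 then 0 else z ^ partitionCrank p) * q ^ n)
      ((1 - q) / poch q (z * q) * (poch q (q * q) / poch q (q / z) - 1)) := by
  have hq1 : ‖q‖ < 1 := hq.trans (by norm_num)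
  have hz0 : z ≠ 0 := by rintro rfl; simp at hz
  have hqz : ‖q / z‖ < 1 := by rwa [norm_div, hz, div_one]
  refine hasSum_partition_fiberwise hq _ (fun n p => ?_) (fun n p => p.parts.count 1)
    (fun j => (1 - q) / poch q (z * q) *
      (qbinCoeff q (z * q) j * (q / z) ^ j - if j = 0 then 1 else 0)) (fun j => ?_) ?_
  · split_ifs
    · simp
    · rw [norm_zpow, hz, one_zpow]
  · rcases Nat.eq_zero_or_pos j with rfl | hj
    · refine hasSum_of_eq hasSum_zero (fun n => ?_) (by simp [qbinCoeff_zero])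
      rw [Finset.sum_eq_zero, zero_mul]
      intro p _
      split_ifs <;> rfl
    · have e1 := hasEval_crankWeight (u := fun c => if c = j then 1 else 0) (s := q ^ j) hq hz
        (fun c => by split_ifs <;> simp) hj (by
          refine hasSum_of_eq (hasSum_ite_eq (j - 1) (q ^ j)) (fun c => ?_) rfl
          by_cases h : c + 1 = j
          · simp [show c = j - 1 by omega, Nat.sub_add_cancel hj]
          · simp [h, show ¬ c = j - 1 by omega])
      have e2 := hasEval_crankWeight (u := fun _ => 0) (s := 0) hq hz (fun c => by simp) hj
        (by simp)
      refine hasSum_of_eq ((HasSum.sub e1 e2).mul_left (z⁻¹ ^ j)) (fun n => ?_) ?_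
      · rw [Nat.Partition.coeff_genFun, Nat.Partition.coeff_genFun, ← sub_mul,
          ← Finset.sum_sub_distrib, ← mul_assoc, Finset.mul_sum]
        congr 1
        refine Finset.sum_congr rfl fun p _ => ?_
        rw [crankWeight_prod z _ hj, crankWeight_prod z _ hj]
        by_cases h1 : p.parts.count 1 = 0
        · simp [h1]
        · by_cases h2 : p.parts.count 1 = j
          · rw [partitionCrank, if_pos h2, if_neg h1, if_neg h1, if_neg h1, if_neg h1, h2,
              if_pos rfl, zpow_sub₀ hz0, zpow_natCast, zpow_natCast, inv_pow]
            ring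
          · simp [h1, h2]
      · rw [if_neg hj.ne', div_pow, inv_pow]
        ring
  · have h := (hasSum_qbin hq1 hqz (z * q)).sub (hasSum_ite_eq 0 (1 : ℂ))
    rw [show z * q * (q / z) = q * q by field_simp] at h
    exact h.mul_left _

/-- The generating function of the crank. -/
theorem hasSum_crank {q z : ℂ} (hq : ‖q‖ < 1 / 2) (hz : ‖z‖ = 1) :
    HasSum (fun n => (∑ p : n.Partition, z ^ partitionCrank p) * q ^ n)
      (q - z * q + poch q q / (poch q (z * q) * poch q (q / z))) := by
  have hq1 : ‖q‖ < 1 := hq.trans (by norm_num)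
  refine hasSum_of_eq ((hasSum_crank_no_ones hq hz).add (hasSum_crank_ones hq hz)) (fun n => ?_) ?_
  · rw [← add_mul, ← Finset.sum_add_distrib]
    congr 1
    refine Finset.sum_congr rfl fun p _ => ?_
    split_ifs <;> simp
  · rw [poch_eq_one_sub_mul hq1 q]
    ring

lemma sum_crankCount {ζ : ℂ} (hζ : ζ ^ 11 = 1) (n : ℕ) :
    ∑ a : Fin 11, (crankCount (a : ℕ) n : ℂ) * ζ ^ (a : ℕ) =
      (∑ p : n.Partition, ζ ^ partitionCrank p) + if n = 1 then ζ - 1 else 0 := by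
  have h0 : ζ ≠ 0 := by rintro rfl; norm_num at hζ
  by_cases hn : n = 1
  · subst hn
    have hc : partitionCrank (default : Nat.Partition 1) = -1 := by
      simp [partitionCrank, default, Nat.Partition.indiscrete]
    rw [Fintype.sum_unique (ι := Nat.Partition 1), hc, if_pos rfl, zpow_neg_one,
      show ζ⁻¹ = ζ ^ 10 from inv_eq_of_mul_eq_one_right (by rw [← pow_succ', hζ])]
    simp only [Fin.sum_univ_succ, Fin.sum_univ_zero, Fin.val_zero, Fin.val_succ]
    norm_num [crankCount]
    ring
  · simp only [if_neg hn, add_zero, crankCount, Finset.card_filter]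
    push_cast
    simp only [Finset.sum_mul]
    rw [Finset.sum_comm]
    refine Finset.sum_congr rfl fun p _ => ?_
    have hlt : (partitionCrank p % 11).toNat < 11 := by omega
    rw [Finset.sum_eq_single ⟨_, hlt⟩]
    · rw [if_pos (by simp only; omega), one_mul]
      conv_rhs => rw [← Int.mul_ediv_add_emod (partitionCrank p) 11, zpow_add₀ h0, zpow_mul,
        show ζ ^ (11 : ℤ) = 1 by exact_mod_cast hζ, one_zpow, one_mul]
      rw [← zpow_natCast]
      congr 1
      exact Int.toNat_of_nonneg (by omega)
    · intro b _ hb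
      rw [if_neg, zero_mul]
      intro h
      exact hb (Fin.ext (by simp only; omega))
    · simp

theorem hasSum_crankCount {q ζ : ℂ} (hq0 : q ≠ 0) (hq : ‖q‖ < 1 / 2) (hζ : ζ ^ 11 = 1) :
    ∃ C, HasSum (fun n => (∑ a : Fin 11, (crankCount (a : ℕ) n : ℂ) * ζ ^ (a : ℕ)) * q ^ n) C ∧
      C * theta q ζ = (1 - ζ) * poch q q ^ 2 := by
  have hq1 : ‖q‖ < 1 := hq.trans (by norm_num)
  have h0 : ζ ≠ 0 := by rintro rfl; norm_num at hζ
  have hz : ‖ζ‖ = 1 := Complex.norm_eq_one_of_pow_eq_one hζ (by norm_num)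
  have h1 : poch q (ζ * q) ≠ 0 :=
    poch_ne_zero hq1 (one_sub_mul_pow_ne_zero hq1 (by rwa [norm_mul, hz, one_mul]))
  have h2 : poch q (q / ζ) ≠ 0 :=
    poch_ne_zero hq1 (one_sub_mul_pow_ne_zero hq1 (by rwa [norm_div, hz, div_one]))
  refine ⟨poch q q / (poch q (ζ * q) * poch q (q / ζ)), ?_, ?_⟩
  · refine hasSum_of_eq ((hasSum_crank hq hz).add (hasSum_ite_eq 1 ((ζ - 1) * q))) (fun n => ?_)
      (by ring)
    rw [sum_crankCount hζ, add_mul]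
    split_ifs with h
    · rw [h, pow_one]
    · rw [zero_mul]
  · rw [theta_eq_prod hq0 hq1 h0, poch_eq_one_sub_mul hq1 ζ]
    field_simp

/-- The exponent of the `k`-th term of `jtheta a m`. -/
def jexp (a m k : ℤ) : ℤ := m * tri k + a * k

lemma two_mul_jexp (a m k : ℤ) : 2 * jexp a m k = m * (k * (k - 1)) + 2 * a * k := by
  rw [jexp, ← two_mul_tri]
  ring

lemma abs_le_jexp {a m : ℤ} (ha : 0 < a) (ham : a < m) (k : ℤ) : |k| ≤ jexp a m k := by
  have h := two_mul_jexp a m k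
  rcases le_or_gt k 0 with hk | hk
  · rw [abs_of_nonpos hk]
    rcases hk.eq_or_lt with rfl | hk
    · linarith
    · nlinarith [mul_nonneg (sub_nonneg.2 (show a + 1 ≤ m from ham))
          (mul_nonneg (show 0 ≤ -k by omega) (show 0 ≤ 1 - k by omega)),
        mul_nonneg ha.le (mul_nonneg (show 0 ≤ -k by omega) (show 0 ≤ -k - 1 by omega))]
  · rw [abs_of_pos hk]
    nlinarith [mul_nonneg (show 0 ≤ m by omega) (mul_nonneg hk.le (show 0 ≤ k - 1 by omega)),
      mul_nonneg (show 0 ≤ a - 1 by omega) hk.le]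

lemma thetaTerm_zpow {q : ℂ} (hq : q ≠ 0) (a m k : ℤ) :
    thetaTerm (q ^ m) (q ^ a) k = (-1) ^ k.natAbs * q ^ jexp a m k := by
  rw [thetaTerm, ← zpow_mul, ← zpow_mul, mul_assoc, ← zpow_add₀ hq, jexp]
  congr 1
  rcases Int.natAbs_eq k with h | h
  · conv_lhs => rw [h, zpow_natCast]
  · conv_lhs => rw [h, zpow_neg, zpow_natCast, ← inv_pow, inv_neg_one]

lemma hasEval_jtheta {a m : ℤ} (ha : 0 < a) (ham : a < m) {q : ℂ} (hq0 : q ≠ 0) (hq1 : ‖q‖ < 1) :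
    HasEval q ((jtheta a m).map (algebraMap ℚ ℂ)) (theta (q ^ m) (q ^ a)) := by
  have hm : ‖q ^ m‖ < 1 := by
    rw [norm_zpow]
    exact zpow_lt_one₀ (norm_pos_iff.2 hq0) hq1 (ha.trans ham)
  have hs := (hasSum_theta (zpow_ne_zero m hq0) hm (zpow_ne_zero a hq0)).tsum_fiberwise
    fun k => (jexp a m k).toNat
  refine hasSum_of_eq hs (fun n => ?_) rfl
  have hiff (k : ℤ) : m * (k * (k - 1)) + 2 * a * k = 2 * (n : ℤ) ↔ (jexp a m k).toNat = n := by
    have h1 := two_mul_jexp a m k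
    have h2 := (abs_nonneg k).trans (abs_le_jexp ha ham k)
    omega
  rw [jtheta, PowerSeries.coeff_map, PowerSeries.coeff_mk, tsum_subtype, map_sum, Finset.sum_mul,
    tsum_eq_sum (s := Finset.Icc (-(n : ℤ)) n)]
  · refine Finset.sum_congr rfl fun k _ => ?_
    have h0 := (abs_nonneg k).trans (abs_le_jexp ha ham k)
    by_cases h : (jexp a m k).toNat = n
    · rw [if_pos ((hiff k).2 h), Set.indicator_of_mem (by simpa using h), thetaTerm_zpow hq0,
        ← zpow_natCast q n, show jexp a m k = n by omega]
      simp
    · rw [if_neg (mt (hiff k).1 h), Set.indicator_of_notMem (by simpa using h)]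
      simp
  · intro k hk
    refine Set.indicator_of_notMem (fun h => hk ?_) _
    have h1 := abs_le_jexp ha ham k
    have h2 := (abs_nonneg k).trans h1
    have h3 : (jexp a m k).toNat = n := by simpa using h
    rw [Finset.mem_Icc, ← abs_le]
    omega

lemma hasEval_Xser {i : ℕ} (h0 : 0 < i) (h1 : i ≤ 5) {q : ℂ} (hq0 : q ≠ 0) (hq1 : ‖q‖ < 1) :
    HasEval q ((Xser i).map (algebraMap ℚ ℂ)) (xTheta q i) := by
  have h := hasEval_jtheta (a := 11 * i) (m := 121) (by omega) (by omega) hq0 hq1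
  rw [Xser, xTheta]
  exact_mod_cast h

lemma Jser_eq_jtheta (m : ℤ) : Jser m = jtheta m (3 * m) := by
  ext n
  rw [Jser, jtheta, PowerSeries.coeff_mk, PowerSeries.coeff_mk]
  refine Finset.sum_congr rfl fun k _ => ?_
  rw [show 3 * m * (k * (k - 1)) + 2 * m * k = m * (k * (3 * k - 1)) by ring]

lemma hasEval_Jser {q : ℂ} (hq0 : q ≠ 0) (hq1 : ‖q‖ < 1) :
    HasEval q ((Jser 121).map (algebraMap ℚ ℂ)) (poch (q ^ 121) (q ^ 121)) := by
  have h := hasEval_jtheta (a := 121) (m := 3 * 121) (by omega) (by omega) hq0 hq1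
  rw [Jser_eq_jtheta, ← theta_cube_self (pow_ne_zero 121 hq0) (norm_pow_lt_one hq1 (by norm_num)),
    ← pow_mul]
  exact_mod_cast h

lemma constantCoeff_jtheta {a m : ℤ} : PowerSeries.constantCoeff (jtheta a m) = 1 := by
  simp [jtheta, ← PowerSeries.coeff_zero_eq_constantCoeff_apply]

lemma eq_zero_of_hasSum_zero {f : ℕ → ℂ}
    (h : ∀ q : ℂ, q ≠ 0 → ‖q‖ < 1 / 2 → HasSum (fun n => f n * q ^ n) 0) (n : ℕ) : f n = 0 := by
  induction n using Nat.strong_induction_on with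
  | _ n ih =>
    have hs (q : ℂ) (hq0 : q ≠ 0) (hq : ‖q‖ < 1 / 2) :
        HasSum (fun m => f (m + n) * q ^ m) 0 := by
      have h1 := (hasSum_nat_add_iff' n).2 (h q hq0 hq)
      rw [Finset.sum_eq_zero (fun i hi => by rw [ih i (Finset.mem_range.1 hi), zero_mul]),
        sub_zero] at h1
      refine hasSum_of_eq (h1.mul_right (q ^ n)⁻¹) (fun m => ?_) (by simp)
      rw [pow_add]
      field_simp
    have hb := (hs (1 / 4) (by norm_num) (by norm_num)).summable.norm
    have hlim := tendsto_tsum_of_dominated_convergence (𝓕 := 𝓝[≠] (0 : ℂ)) hb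
      (f := fun q m => f (m + n) * q ^ m) (g := fun m => f (m + n) * 0 ^ m)
      (fun m => ((continuous_const.mul (continuous_pow m)).tendsto 0).mono_left
        nhdsWithin_le_nhds) (by
        filter_upwards [nhdsWithin_le_nhds (Metric.ball_mem_nhds (0 : ℂ) (ε := 1 / 4)
          (by norm_num))] with q hq m
        rw [mem_ball_zero_iff] at hq
        rw [norm_mul, norm_mul, norm_pow, norm_pow]
        gcongr
        exact hq.le.trans (by norm_num))
    have h0 : Tendsto (fun q : ℂ => ∑' m, f (m + n) * q ^ m) (𝓝[≠] 0) (𝓝 0) := by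
      refine tendsto_const_nhds.congr' ?_
      filter_upwards [self_mem_nhdsWithin, nhdsWithin_le_nhds (Metric.ball_mem_nhds (0 : ℂ)
        (ε := 1 / 2) (by norm_num))] with q hq0 hq
      exact (hs q hq0 (mem_ball_zero_iff.1 hq)).tsum_eq.symm
    have h1 := tendsto_nhds_unique hlim h0
    rw [tsum_eq_single 0 (fun m hm => by rw [zero_pow hm, mul_zero])] at h1
    simpa using h1

/-- Power series that agree on a punctured disc are equal. -/
lemma eq_of_hasEval {φ ψ : PowerSeries ℂ}
    (h : ∀ q : ℂ, q ≠ 0 → ‖q‖ < 1 / 2 → ∃ v, HasEval q φ v ∧ HasEval q ψ v) : φ = ψ := by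
  ext n
  refine sub_eq_zero.1 (eq_zero_of_hasSum_zero
    (f := fun n => PowerSeries.coeff n φ - PowerSeries.coeff n ψ) (fun q hq0 hq => ?_) n)
  obtain ⟨v, h1, h2⟩ := h q hq0 hq
  exact hasSum_of_eq (HasSum.sub h1 h2) (fun n => sub_mul _ _ _) (sub_self v).symm

/-- The only rational linear relations between the powers of a primitive 11th root of unity are the
multiples of the vanishing of their sum. -/
lemma eq_last_of_sum_mul_pow_eq_zero {ζ : ℂ} (hζ : IsPrimitiveRoot ζ 11) (c : Fin 11 → ℚ)
    (h : ∑ a : Fin 11, (c a : ℂ) * ζ ^ (a : ℕ) = 0) (a : Fin 11) : c a = c (Fin.last 10) := by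
  set r : Polynomial ℚ :=
    ∑ i : Fin 10, Polynomial.C (c i.castSucc - c (Fin.last 10)) * Polynomial.X ^ (i : ℕ) with hr
  have hsum : ∑ a : Fin 11, ζ ^ (a : ℕ) = 0 := by
    rw [Fin.sum_univ_eq_sum_range (fun i => ζ ^ i)]
    exact hζ.geom_sum_eq_zero (by norm_num)
  have hr0 : Polynomial.aeval ζ r = 0 := by
    rw [Fin.sum_univ_castSucc] at h hsum
    simp only [hr, map_sum, map_mul, map_pow, Polynomial.aeval_C, Polynomial.aeval_X, map_sub,
      sub_mul, Finset.sum_sub_distrib, ← Finset.mul_sum, eq_ratCast]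
    simp only [Fin.val_castSucc] at h hsum
    linear_combination h - (c (Fin.last 10) : ℂ) * hsum
  have hdvd : Polynomial.cyclotomic 11 ℚ ∣ r := by
    rw [Polynomial.cyclotomic_eq_minpoly_rat hζ (by norm_num)]
    exact minpoly.dvd ℚ ζ hr0
  have hzero : r = 0 := by
    refine Polynomial.eq_zero_of_dvd_of_degree_lt hdvd ?_
    rw [Polynomial.degree_cyclotomic, show Nat.totient 11 = 10 by decide]
    exact Polynomial.degree_sum_fin_lt _
  induction a using Fin.lastCases with
  | last => rfl
  | cast i =>
    have hi := congrArg (fun p => Polynomial.coeff p i) hzero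
    simp only [hr, Polynomial.finsetSum_coeff, Polynomial.coeff_C_mul, Polynomial.coeff_X_pow,
      Polynomial.coeff_zero, mul_ite, mul_one, mul_zero, Fin.val_inj, Finset.sum_ite_eq,
      Finset.mem_univ, if_true] at hi
    exact sub_eq_zero.1 hi

lemma sum_crankCount_eq (n : ℕ) :
    ∑ a : Fin 11, crankCount (a : ℕ) n = partitionCount n := by
  have h := sum_crankCount (one_pow 11) n
  simp only [one_pow, mul_one, one_zpow, sub_self, ite_self, add_zero, Finset.sum_const,
    Finset.card_univ, nsmul_eq_mul] at h
  exact_mod_cast h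

lemma sum_dissCoeff (t : Fin 10) : ∑ a, dissCoeff a t = 0 := by
  revert t
  decide

/-- The generating function of the crank counts of a residue class. -/
def crankSeries (a : ℕ) : PowerSeries ℚ := PowerSeries.mk fun n => (crankCount a n : ℚ)

/-- The common denominator of the theta quotients. -/
def xProd : PowerSeries ℚ := Xser 1 * Xser 2 * Xser 3 * Xser 4 * Xser 5

/-- The numerators of the theta quotients over the common denominator. -/
def xNum : Fin 10 → PowerSeries ℚ :=
  dissNum PowerSeries.X (Xser 1) (Xser 2) (Xser 3) (Xser 4) (Xser 5)

lemma hasEval_xNum {q : ℂ} (hq0 : q ≠ 0) (hq1 : ‖q‖ < 1) (t : Fin 10) :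
    HasEval q ((xNum t).map (algebraMap ℚ ℂ)) (dissNum q (xTheta q 1) (xTheta q 2) (xTheta q 3)
      (xTheta q 4) (xTheta q 5) t) := by
  have hX := hasEval_X q
  have h1 := hasEval_Xser (i := 1) (by norm_num) (by norm_num) hq0 hq1
  have h2 := hasEval_Xser (i := 2) (by norm_num) (by norm_num) hq0 hq1
  have h3 := hasEval_Xser (i := 3) (by norm_num) (by norm_num) hq0 hq1
  have h4 := hasEval_Xser (i := 4) (by norm_num) (by norm_num) hq0 hq1
  have h5 := hasEval_Xser (i := 5) (by norm_num) (by norm_num) hq0 hq1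
  have key : (xNum t).map (algebraMap ℚ ℂ) = dissNum PowerSeries.X
      ((Xser (1 : ℕ)).map (algebraMap ℚ ℂ)) ((Xser (2 : ℕ)).map (algebraMap ℚ ℂ))
      ((Xser (3 : ℕ)).map (algebraMap ℚ ℂ)) ((Xser (4 : ℕ)).map (algebraMap ℚ ℂ))
      ((Xser (5 : ℕ)).map (algebraMap ℚ ℂ)) t := by
    fin_cases t <;> simp [xNum, dissNum]
  rw [key]
  generalize PowerSeries.map (algebraMap ℚ ℂ) (Xser (1 : ℕ)) = y₁ at *
  generalize PowerSeries.map (algebraMap ℚ ℂ) (Xser (2 : ℕ)) = y₂ at *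
  generalize PowerSeries.map (algebraMap ℚ ℂ) (Xser (3 : ℕ)) = y₃ at *
  generalize PowerSeries.map (algebraMap ℚ ℂ) (Xser (4 : ℕ)) = y₄ at *
  generalize PowerSeries.map (algebraMap ℚ ℂ) (Xser (5 : ℕ)) = y₅ at *
  clear key
  fin_cases t
  · exact ((h2.mul h3).mul h4).mul h5
  · exact hX.mul ((h1.mul h4).mul (h5.pow 2))
  · exact (hX.pow 2).mul ((h2.mul (h3.pow 2)).mul h5)
  · exact (hX.pow 3).mul (((h2.pow 2).mul h4).mul h5)
  · exact (hX.pow 4).mul (((h1.mul h3).mul h4).mul h5)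
  · exact (hX.pow 5).mul ((h1.mul h3).mul (h4.pow 2))
  · exact (hX.pow 7).mul (((h1.mul h2).mul h4).mul h5)
  · exact (hX.pow 19).mul (((h1.pow 2).mul h2).mul h3)
  · exact (hX.pow 9).mul (((h1.mul h2).mul h3).mul h5)
  · exact (hX.pow 10).mul (((h1.mul h2).mul h3).mul h4)

/-- The difference of the two sides of the dissection of `11 * crankSeries a`, up to a multiple of
the partition generating function. -/
def crankDefect (a : Fin 11) : PowerSeries ℚ :=
  11 * crankSeries a * xProd - Jser 121 ^ 2 * ∑ t, (dissCoeff a t : PowerSeries ℚ) * xNum t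

lemma sum_crankDefect_map {ζ : ℂ} (hζ : IsPrimitiveRoot ζ 11) :
    ∑ a : Fin 11, PowerSeries.C (ζ ^ (a : ℕ)) * (crankDefect a).map (algebraMap ℚ ℂ) = 0 := by
  have e : ∑ a : Fin 11, PowerSeries.C (ζ ^ (a : ℕ)) * (crankDefect a).map (algebraMap ℚ ℂ) =
      PowerSeries.C 11 * (PowerSeries.mk fun n =>
        ∑ a : Fin 11, (crankCount (a : ℕ) n : ℂ) * ζ ^ (a : ℕ)) *
        xProd.map (algebraMap ℚ ℂ) - (Jser 121).map (algebraMap ℚ ℂ) ^ 2 *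
        ∑ t, PowerSeries.C (∑ a : Fin 11, (dissCoeff a t : ℂ) * ζ ^ (a : ℕ)) *
          (xNum t).map (algebraMap ℚ ℂ) := by
    have h1 : (PowerSeries.mk fun n => ∑ a : Fin 11, (crankCount (a : ℕ) n : ℂ) * ζ ^ (a : ℕ)) =
        ∑ a : Fin 11, PowerSeries.C (ζ ^ (a : ℕ)) *
          (crankSeries (a : ℕ)).map (algebraMap ℚ ℂ) := by
      ext n
      rw [map_sum, PowerSeries.coeff_mk]
      refine Finset.sum_congr rfl fun a _ => ?_
      rw [PowerSeries.coeff_C_mul, PowerSeries.coeff_map, crankSeries, PowerSeries.coeff_mk,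
        mul_comm, map_intCast]
    have h2 (t : Fin 10) : PowerSeries.C (∑ a : Fin 11, (dissCoeff a t : ℂ) * ζ ^ (a : ℕ)) =
        ∑ a : Fin 11, (dissCoeff a t : PowerSeries ℂ) * PowerSeries.C (ζ ^ (a : ℕ)) := by
      simp only [map_sum, map_mul, map_intCast]
    rw [h1, map_ofNat, Finset.mul_sum, Finset.sum_mul]
    simp only [h2, Finset.sum_mul]
    rw [Finset.sum_comm, Finset.mul_sum, ← Finset.sum_sub_distrib]
    refine Finset.sum_congr rfl fun a _ => ?_
    simp only [crankDefect, map_sub, map_mul, map_pow, map_sum, map_intCast, map_ofNat, mul_sub]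
    congr 1
    · ring
    · rw [mul_left_comm, Finset.mul_sum]
      congr 1
      exact Finset.sum_congr rfl fun t _ => by ring
  rw [e, sub_eq_zero]
  refine eq_of_hasEval fun q hq0 hq => ?_
  have hq1 : ‖q‖ < 1 := hq.trans (by norm_num)
  obtain ⟨C, hC, hCt⟩ := hasSum_crankCount hq0 hq hζ.pow_eq_one
  refine ⟨_, ?_, ((hasEval_Jser hq0 hq1).pow 2).mul (hasEval_sum _ fun t _ =>
    (hasEval_C q _).mul (hasEval_xNum hq0 hq1 t))⟩
  rw [← crank_theta_dissection hq0 hq1 hζ hCt]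
  refine ((hasEval_C q 11).mul ?_).mul ?_
  · exact hasSum_of_eq hC (fun n => by rw [PowerSeries.coeff_mk]) rfl
  · rw [xProd, map_mul, map_mul, map_mul, map_mul]
    have h (i : ℕ) (h0 : 0 < i) (h1 : i ≤ 5) := hasEval_Xser h0 h1 hq0 hq1
    exact ((((h 1 (by norm_num) (by norm_num)).mul (h 2 (by norm_num) (by norm_num))).mul
      (h 3 (by norm_num) (by norm_num))).mul (h 4 (by norm_num) (by norm_num))).mul
      (h 5 (by norm_num) (by norm_num))

lemma crankDefect_eq (a : Fin 11) : crankDefect a = crankDefect (Fin.last 10) := by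
  have hζ := Complex.isPrimitiveRoot_exp 11 (by norm_num)
  have h := sum_crankDefect_map hζ
  ext n
  refine eq_last_of_sum_mul_pow_eq_zero hζ (fun a => PowerSeries.coeff n (crankDefect a)) ?_ a
  have hn := congrArg (PowerSeries.coeff n) h
  rw [map_sum, map_zero] at hn
  rw [← hn]
  refine Finset.sum_congr rfl fun b _ => ?_
  rw [PowerSeries.coeff_C_mul, PowerSeries.coeff_map, eq_ratCast, mul_comm]

/-- The generating function of the partition numbers. -/
def partitionSeries : PowerSeries ℚ := PowerSeries.mk fun n => (partitionCount n : ℚ)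

lemma sum_crankSeries : ∑ a : Fin 11, crankSeries a = partitionSeries := by
  ext n
  rw [map_sum, partitionSeries, PowerSeries.coeff_mk]
  simp only [crankSeries, PowerSeries.coeff_mk]
  exact_mod_cast sum_crankCount_eq n

lemma crankDefect_eq_mul (a : Fin 11) : crankDefect a = partitionSeries * xProd := by
  have h : ∑ b, crankDefect b = 11 * (partitionSeries * xProd) := by
    simp only [crankDefect, Finset.sum_sub_distrib, ← Finset.mul_sum, ← Finset.sum_mul]
    rw [sum_crankSeries, Finset.sum_comm]
    simp only [← Finset.sum_mul, ← Int.cast_sum, sum_dissCoeff]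
    simp [mul_assoc]
  rw [Finset.sum_congr rfl fun b _ => (crankDefect_eq b).trans (crankDefect_eq a).symm,
    Finset.sum_const, Finset.card_univ, Fintype.card_fin, nsmul_eq_mul] at h
  have := algebraRat.charZero (PowerSeries ℚ)
  exact mul_left_cancel₀ (by norm_num) h

lemma Xser_mul_inv (i : ℤ) : Xser i * (Xser i)⁻¹ = 1 :=
  PowerSeries.mul_inv_cancel _ (by rw [Xser, constantCoeff_jtheta]; exact one_ne_zero)

lemma xProd_ne_zero : xProd ≠ 0 := by
  have h (i : ℤ) : Xser i ≠ 0 := left_ne_zero_of_mul_eq_one (Xser_mul_inv i)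
  simp [xProd, h]

lemma v11_mul_xProd (d : Fin 10 → ℤ) :
    v11 (d 0) (d 1) (d 2) (d 3) (d 4) (d 5) (d 6) (d 7) (d 8) (d 9) * xProd =
      Jser 121 ^ 2 * ∑ t, (d t : PowerSeries ℚ) * xNum t := by
  have h1 := Xser_mul_inv 1
  have h2 := Xser_mul_inv 2
  have h3 := Xser_mul_inv 3
  have h4 := Xser_mul_inv 4
  have h5 := Xser_mul_inv 5
  rw [v11, mul_assoc]
  congr 1
  simp only [xProd, xNum, dissNum, Fin.sum_univ_succ, Fin.sum_univ_zero]
  generalize (Xser 1)⁻¹ = z₁ at *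
  generalize (Xser 2)⁻¹ = z₂ at *
  generalize (Xser 3)⁻¹ = z₃ at *
  generalize (Xser 4)⁻¹ = z₄ at *
  generalize (Xser 5)⁻¹ = z₅ at *
  generalize Xser 1 = x₁ at *
  generalize Xser 2 = x₂ at *
  generalize Xser 3 = x₃ at *
  generalize Xser 4 = x₄ at *
  generalize Xser 5 = x₅ at *
  generalize (PowerSeries.X : PowerSeries ℚ) = X at *
  simp only [Matrix.cons_val, Fin.succ_zero_eq_one, Fin.succ_one_eq_two, Fin.reduceSucc, add_zero]
  linear_combination d 0 * (x₂ * x₃ * x₄ * x₅) * h1 +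
    d 1 * X * x₁ * x₄ * x₅ ^ 2 * (x₃ * z₃ * h2 + h3) +
    d 2 * X ^ 2 * x₂ * x₃ ^ 2 * x₅ * (x₄ * z₄ * h1 + h4) +
    d 3 * X ^ 3 * x₂ ^ 2 * x₄ * x₅ * (x₃ * z₃ * h1 + h3) +
    d 4 * X ^ 4 * x₁ * x₃ * x₄ * x₅ * h2 +
    d 5 * X ^ 5 * x₁ * x₃ * x₄ ^ 2 * (x₅ * z₅ * h2 + h5) +
    d 6 * X ^ 7 * x₁ * x₂ * x₄ * x₅ * h3 +
    d 7 * X ^ 19 * x₁ ^ 2 * x₂ * x₃ * (x₅ * z₅ * h4 + h5) +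
    d 8 * X ^ 9 * x₁ * x₂ * x₃ * x₅ * h4 + d 9 * X ^ 10 * x₁ * x₂ * x₃ * x₄ * h5

theorem mk_crank_deviation (a : Fin 11) :
    (PowerSeries.mk fun n => ((11 * crankCount (a : ℕ) n - (partitionCount n : ℤ) : ℤ) : ℚ)) =
      v11 (dissCoeff a 0) (dissCoeff a 1) (dissCoeff a 2) (dissCoeff a 3) (dissCoeff a 4)
        (dissCoeff a 5) (dissCoeff a 6) (dissCoeff a 7) (dissCoeff a 8) (dissCoeff a 9) := by
  have h : (PowerSeries.mk fun n =>
      ((11 * crankCount (a : ℕ) n - (partitionCount n : ℤ) : ℤ) : ℚ)) =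
      11 * crankSeries a - partitionSeries := by
    ext n
    rw [map_sub, ← map_ofNat PowerSeries.C 11, PowerSeries.coeff_C_mul]
    simp [crankSeries, partitionSeries]
  refine mul_right_cancel₀ xProd_ne_zero ?_
  rw [v11_mul_xProd, h, sub_mul, ← crankDefect_eq_mul a, crankDefect, sub_sub_cancel]

end CrankDissection

/-- The 11-dissection of the deviation of the crank modulo 11. -/
theorem crank_dissection_mod_eleven :
    ((PowerSeries.mk fun n => ((11 * crankCount 0 n - (partitionCount n : ℤ) : ℤ) : ℚ)) =
      v11 10 (-12) (-2) 8 6 4 (-4) (-6) (-8) 2)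
    ∧ ((PowerSeries.mk fun n => ((11 * crankCount 1 n - (partitionCount n : ℤ) : ℤ) : ℚ)) =
      v11 (-1) 10 (-2) (-3) (-5) 4 7 5 3 2)
    ∧ ((PowerSeries.mk fun n => ((11 * crankCount 2 n - (partitionCount n : ℤ) : ℤ) : ℚ)) =
      v11 (-1) (-1) 9 (-3) 6 (-7) (-4) (-6) 3 2)
    ∧ ((PowerSeries.mk fun n => ((11 * crankCount 3 n - (partitionCount n : ℤ) : ℤ) : ℚ)) =
      v11 (-1) (-1) (-2) 8 (-5) 4 (-4) 5 3 (-9))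
    ∧ ((PowerSeries.mk fun n => ((11 * crankCount 4 n - (partitionCount n : ℤ) : ℤ) : ℚ)) =
      v11 (-1) (-1) (-2) (-3) 6 (-7) 7 5 (-8) 2)
    ∧ ((PowerSeries.mk fun n => ((11 * crankCount 5 n - (partitionCount n : ℤ) : ℤ) : ℚ)) =
      v11 (-1) (-1) (-2) (-3) (-5) 4 (-4) (-6) 3 2) :=
  ⟨CrankDissection.mk_crank_deviation 0, CrankDissection.mk_crank_deviation 1,
    CrankDissection.mk_crank_deviation 2, CrankDissection.mk_crank_deviation 3,
    CrankDissection.mk_crank_deviation 4, CrankDissection.mk_crank_deviation 5⟩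

end
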